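/- Let T be a regular interval exchange transformation on [ℓ,r) defined over a quadratic field, i.e., all the lengths of the exchanged semi-intervals belong to ℚ(√d) for some squarefree integer d ≥ 2. Then the family of all transformations induced by T on semi-intervals admissible for T contains only finitely many distinct transformations up to equivalence; i.e., the set of equivalence classes of induced transformations of T on admissible semi-intervals is finite. -/

import Mathlib

open Set MeasureTheory

noncomputable section

/-- Left endpoint `γ i` of the `i`-th exchanged semi-interval. -/
def sepPt {s : ℕ} (l : ℝ) (len : Fin s → ℝ) (i : Fin s) : ℝ :=
  l + ∑ j ∈ Finset.univ.filter (fun j => j < i), len j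

/-- Left endpoint `δ` of the image of the `i`-th exchanged semi-interval. -/
def imgPt {s : ℕ} (l : ℝ) (len : Fin s → ℝ) (π : Equiv.Perm (Fin s)) (i : Fin s) : ℝ :=
  l + ∑ j ∈ Finset.univ.filter (fun j => π j < π i), len j

/-- `T` is the `s`-interval exchange transformation on `[l,r)` with lengths `len`
and permutation `π`, extended by the identity outside `[l,r)`. -/
def IsIET (s : ℕ) (l r : ℝ) (len : Fin s → ℝ) (π : Equiv.Perm (Fin s))
    (T : Equiv.Perm ℝ) : Prop :=
  l < r ∧ (∀ i, 0 < len i) ∧ (∑ i, len i) = r - l ∧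
  (∀ z, z ∉ Set.Ico l r → T z = z) ∧
  ∀ i : Fin s, ∀ z ∈ Set.Ico (sepPt l len i) (sepPt l len i + len i),
    T z = z + (imgPt l len π i - sepPt l len i)

/-- The two-sided orbit `{T^n z : n ∈ ℤ}`. -/
def orbitZ (T : Equiv.Perm ℝ) (z : ℝ) : Set ℝ := {w | ∃ n : ℤ, (T ^ n) z = w}

/-- Regularity (idoc): the orbits of the nonzero separation points are infinite
and pairwise disjoint. -/
def IsRegularIET (s : ℕ) (l : ℝ) (len : Fin s → ℝ) (T : Equiv.Perm ℝ) : Prop :=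
  (∀ i : Fin s, (i : ℕ) ≠ 0 → (orbitZ T (sepPt l len i)).Infinite) ∧
  (∀ i j : Fin s, (i : ℕ) ≠ 0 → (j : ℕ) ≠ 0 → i ≠ j →
    Disjoint (orbitZ T (sepPt l len i)) (orbitZ T (sepPt l len j)))

/-- Minimality: every (two-sided) orbit of a point of `[l,r)` is dense in `[l,r)`. -/
def IsMinimalOn (T : Equiv.Perm ℝ) (l r : ℝ) : Prop :=
  ∀ z ∈ Set.Ico l r, Set.Ico l r ⊆ closure (orbitZ T z)

/-- First return time of `z` in `I` (defined via `sInf`; meaningful when `T` is minimal). -/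
def returnTime (T : Equiv.Perm ℝ) (I : Set ℝ) (z : ℝ) : ℕ :=
  sInf {n : ℕ | 0 < n ∧ (T ^ n) z ∈ I}

/-- The transformation induced by `T` on `I` (first-return map). -/
def inducedMap (T : Equiv.Perm ℝ) (I : Set ℝ) (z : ℝ) : ℝ :=
  (T ^ returnTime T I z) z

/-- The transformation induced by `T` on `[u,v)` is an interval exchange
transformation on `k` intervals with data `(lam, σ)`. -/
def InducedData (T : Equiv.Perm ℝ) (u v : ℝ) (k : ℕ) (lam : Fin k → ℝ)
    (σ : Equiv.Perm (Fin k)) : Prop :=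
  ∃ S : Equiv.Perm ℝ, IsIET k u v lam σ S ∧
    ∀ z ∈ Set.Ico u v, S z = inducedMap T (Set.Ico u v) z

/-- The semi-interval `[l,t)` is right admissible for `T`. -/
def RightAdmissible (s : ℕ) (l r : ℝ) (len : Fin s → ℝ) (T : Equiv.Perm ℝ)
    (t : ℝ) : Prop :=
  l < t ∧ t < r ∧ ∃ (i : Fin s) (k : ℤ), t = (T ^ k) (sepPt l len i) ∧
    (0 < k → ∀ h : ℤ, 0 < h → h < k → t < (T ^ h) (sepPt l len i)) ∧
    (k ≤ 0 → ∀ h : ℤ, k < h → h ≤ 0 → t < (T ^ h) (sepPt l len i))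

/-- `ρ⁺_{I,T}(z) = min {n > 0 : T^n z ∈ (u,v)}`. -/
def rhoPlusPt (T : Equiv.Perm ℝ) (u v z : ℝ) : ℕ :=
  sInf {n : ℕ | 0 < n ∧ (T ^ n) z ∈ Set.Ioo u v}

/-- `ρ⁻_{I,T}(z) = min {n ≥ 0 : T^{-n} z ∈ (u,v)}`. -/
def rhoMinusPt (T : Equiv.Perm ℝ) (u v z : ℝ) : ℕ :=
  sInf {n : ℕ | (T⁻¹ ^ n) z ∈ Set.Ioo u v}

/-- The set of neighbours `N_{I,T}(z)` of `z` with respect to `I = [u,v)` and `T`. -/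
def neighbours (T : Equiv.Perm ℝ) (u v z : ℝ) : Set ℝ :=
  {w | ∃ k : ℤ, -(rhoMinusPt T u v z : ℤ) ≤ k ∧ k < (rhoPlusPt T u v z : ℤ) ∧
    w = (T ^ k) z}

/-- The set of division points `Div(I,T)` of `I = [u,v)` with respect to `T`. -/
def divPoints (s : ℕ) (l : ℝ) (len : Fin s → ℝ) (T : Equiv.Perm ℝ)
    (u v : ℝ) : Set ℝ :=
  ⋃ i : Fin s, neighbours T u v (sepPt l len i)

/-- The semi-interval `[u,v) ⊆ [l,r)` is admissible for `T`. -/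
def Admissible (s : ℕ) (l r : ℝ) (len : Fin s → ℝ) (T : Equiv.Perm ℝ)
    (u v : ℝ) : Prop :=
  l ≤ u ∧ u < v ∧ v ≤ r ∧
  u ∈ divPoints s l len T u v ∪ {r} ∧ v ∈ divPoints s l len T u v ∪ {r}

/-- A bundled regular `s`-interval exchange transformation. -/
structure RIET (s : ℕ) where
  l : ℝ
  r : ℝ
  len : Fin s → ℝ
  perm : Equiv.Perm (Fin s)
  T : Equiv.Perm ℝ
  isIET : IsIET s l r len perm T
  isReg : IsRegularIET s l len T

/-- The right endpoint `max (γ_s, δ_{π(s)})` of `Z(T)`. -/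
def zPoint {s : ℕ} (X : RIET s) : ℝ :=
  if h : 0 < s then
    max (sepPt X.l X.len ⟨s - 1, by omega⟩)
      (imgPt X.l X.len X.perm (X.perm.symm ⟨s - 1, by omega⟩))
  else X.r

/-- The left endpoint `min (γ_2, δ_{π(2)})` of `Y(T)`. -/
def yPoint {s : ℕ} (X : RIET s) : ℝ :=
  if h : 1 < s then
    min (sepPt X.l X.len ⟨1, h⟩) (imgPt X.l X.len X.perm (X.perm.symm ⟨1, h⟩))
  else X.l

/-- `Y = ψ(X)`: one step of the right Rauzy induction. -/
def PsiStep {s : ℕ} (X Y : RIET s) : Prop :=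
  Y.l = X.l ∧ Y.r = zPoint X ∧
  ∀ z ∈ Set.Ico X.l (zPoint X), Y.T z = inducedMap X.T (Set.Ico X.l (zPoint X)) z

/-- `Y = φ(X)`: one step of the left Rauzy induction. -/
def PhiStep {s : ℕ} (X Y : RIET s) : Prop :=
  Y.l = yPoint X ∧ Y.r = X.r ∧
  ∀ z ∈ Set.Ico (yPoint X) X.r, Y.T z = inducedMap X.T (Set.Ico (yPoint X) X.r) z

/-- Equivalence of two `s`-interval exchange transformations: `(σ, mu)` is obtained
from `(π, lam)` by rescaling, possibly combined with the reversal `τ : i ↦ s - i + 1`. -/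
def IETEquiv (s : ℕ) (π σ : Equiv.Perm (Fin s)) (lam mu : Fin s → ℝ) : Prop :=
  (∃ c : ℝ, 0 < c ∧ σ = π ∧ ∀ i, mu i = c * lam i) ∨
  (∃ c : ℝ, 0 < c ∧ (∀ i, σ i = (π i).rev) ∧ ∀ i, mu i = c * lam i.rev)

/-- The subring `ℤ[√d]` of `ℝ`. -/
def Zsd (d : ℤ) : Set ℝ := {z | ∃ m n : ℤ, z = (m : ℝ) + (n : ℝ) * Real.sqrt d}

/-- `Ψ(z) = max (|m|,|n|)` for `z = m + n√d` (the representation being unique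
when `d ≥ 2` is squarefree). -/
def PsiNum (d : ℤ) (z : ℝ) : ℕ :=
  sInf {k : ℕ | ∃ m n : ℤ, z = (m : ℝ) + (n : ℝ) * Real.sqrt d ∧
    k = max m.natAbs n.natAbs}

/-- `Ψ(S) = max {Ψ(z) : z ∈ ∂S}`. -/
def PsiSet (d : ℤ) (S : Set ℝ) : ℕ := sSup (PsiNum d '' frontier S)

/-- The reduced complexity `Π(S) = |S| ⬝ Ψ(S)`. -/
def PiSet (d : ℤ) (S : Set ℝ) : ℝ := (volume S).toReal * PsiSet d S

/-- `S` belongs to the algebra `A([l,r))`: a nonempty finite union of semi-intervals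
of `[l,r)` with endpoints in `ℤ[√d]`. -/
def MemA (d : ℤ) (l r : ℝ) (S : Set ℝ) : Prop :=
  S.Nonempty ∧ S ⊆ Set.Ico l r ∧
  ∃ (k : ℕ) (a b : Fin k → ℝ), (∀ j, a j ∈ Zsd d ∧ b j ∈ Zsd d ∧ a j < b j) ∧
    S = ⋃ j, Set.Ico (a j) (b j)

/-- The interval exchange transformation with data `(l, r, len, π)` is defined over
`ℤ[√d]`: `l`, `r`, the separation points and the translation values lie in `ℤ[√d]`. -/
def DefinedOverZ (d : ℤ) (s : ℕ) (l r : ℝ) (len : Fin s → ℝ)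
    (π : Equiv.Perm (Fin s)) : Prop :=
  l ∈ Zsd d ∧ r ∈ Zsd d ∧
  ∀ i, sepPt l len i ∈ Zsd d ∧ (imgPt l len π i - sepPt l len i) ∈ Zsd d

/-- Maximal positive return time `ρ⁺(S)`. -/
def rhoPlusSet (T : Equiv.Perm ℝ) (S : Set ℝ) : ℕ :=
  sInf {n : ℕ | 1 ≤ n ∧ ⇑(T ^ n) '' S ⊆ ⋃ i ∈ Finset.range n, ⇑(T ^ i) '' S}

/-- Maximal negative return time `ρ⁻(S)`. -/
def rhoMinusSet (T : Equiv.Perm ℝ) (S : Set ℝ) : ℕ :=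
  sInf {m : ℕ | 1 ≤ m ∧ ⇑(T ^ m) '' S ⊆ ⋃ i ∈ Finset.range m, ⇑(T⁻¹ ^ i) '' S}

/-- Minimal positive return time `σ⁺(S)`. -/
def sigmaPlusSet (T : Equiv.Perm ℝ) (S : Set ℝ) : ℕ :=
  sInf {n : ℕ | 1 ≤ n ∧ (⇑(T ^ n) '' S ∩ S).Nonempty}

/-- Minimal negative return time `σ⁻(S)`. -/
def sigmaMinusSet (T : Equiv.Perm ℝ) (S : Set ℝ) : ℕ :=
  sInf {m : ℕ | 1 ≤ m ∧ (⇑(T⁻¹ ^ m) '' S ∩ S).Nonempty}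

/-- `D_{m,n}(T) = ⋃_{i=-m+1}^{n} T^i (Sep(T))`. -/
def Dmn (s : ℕ) (l : ℝ) (len : Fin s → ℝ) (T : Equiv.Perm ℝ) (m n : ℕ) : Set ℝ :=
  {w | ∃ (i : Fin s) (k : ℤ), -(m : ℤ) + 1 ≤ k ∧ k ≤ (n : ℤ) ∧
    w = (T ^ k) (sepPt l len i)}

/-- `[u,v)` belongs to `U(T) = ⋃_{m,n ≥ 1} U_{m,n}(T)`: it is one of the
semi-intervals into which `D_{m,n}(T)` partitions `[l,r)`. -/
def MemU (s : ℕ) (l r : ℝ) (len : Fin s → ℝ) (T : Equiv.Perm ℝ) (u v : ℝ) : Prop :=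
  ∃ m n : ℕ, 1 ≤ m ∧ 1 ≤ n ∧ u ∈ Dmn s l len T m n ∧
    (v ∈ Dmn s l len T m n ∨ v = r) ∧ ∀ w ∈ Dmn s l len T m n, w ∉ Set.Ioo u v

theorem perm_apply_inv_apply (e : Equiv.Perm ℝ) (x : ℝ) : e (e⁻¹ x) = x := e.apply_symm_apply x

theorem perm_inv_apply_apply (e : Equiv.Perm ℝ) (x : ℝ) : e⁻¹ (e x) = x := e.symm_apply_apply x

/-- `T` permutes `[l,r)`, fixes every other point, moves any two points of `[l,r)` that are not
separated by a point of `D` by the same amount, and has no long wandering semi-intervals. -/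
structure PiecewiseTranslation (T : Equiv.Perm ℝ) (l r : ℝ) (D : Finset ℝ) : Prop where
  fix : ∀ z, z ∉ Ico l r → T z = z
  trans : ∀ y y', l ≤ y → y ≤ y' → y' < r → (∀ x ∈ Ioc y y', x ∉ D) → T y' - y' = T y - y
  wander : ∀ p q (n : ℕ), l ≤ p → p < q → q ≤ r →
    (∀ i : ℕ, 0 < i → i < n → ∀ z ∈ Ico p q, (T ^ i) z ∉ Ico p q) → n * (q - p) ≤ r - l

/-- The points of `(a,b)` whose orbit, up to time `k`, meets `D` before its first return to
`[a,b)`, or meets `{a,b}` at its first return to `[a,b)` or before. -/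
def cutSet (T : Equiv.Perm ℝ) (D : Finset ℝ) (a b : ℝ) (k : ℕ) : Set ℝ :=
  {x | x ∈ Ioo a b ∧
    ((∃ j < k, (∀ i, 0 < i → i ≤ j → (T ^ i) x ∉ Ico a b) ∧ (T ^ j) x ∈ D) ∨
      ∃ j, 0 < j ∧ j ≤ k ∧ (∀ i, 0 < i → i < j → (T ^ i) x ∉ Ico a b) ∧
        ((T ^ j) x = a ∨ (T ^ j) x = b))}

theorem cutSet_mono (T : Equiv.Perm ℝ) (D : Finset ℝ) (a b : ℝ) {k k' : ℕ} (h : k ≤ k') :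
    cutSet T D a b k ⊆ cutSet T D a b k' := by
  rintro x ⟨hx, ⟨j, hj, h1⟩ | ⟨j, hj0, hj, h1⟩⟩
  · exact ⟨hx, Or.inl ⟨j, by omega, h1⟩⟩
  · exact ⟨hx, Or.inr ⟨j, hj0, by omega, h1⟩⟩

/-- All cut points of `[a,b)`. -/
def allCuts (T : Equiv.Perm ℝ) (D : Finset ℝ) (a b : ℝ) : Set ℝ := ⋃ k, cutSet T D a b k

theorem cutSet_subset_allCuts (T : Equiv.Perm ℝ) (D : Finset ℝ) (a b : ℝ) (k : ℕ) :
    cutSet T D a b k ⊆ allCuts T D a b := subset_iUnion _ k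

theorem pow_apply_eq_pow_sub {T : Equiv.Perm ℝ} {x y : ℝ} {j j' : ℕ} (hj : j ≤ j')
    (h : (T ^ j) x = (T ^ j') y) : x = (T ^ (j' - j)) y := by
  apply (T ^ j).injective
  rw [h, ← Equiv.Perm.mul_apply, ← pow_add]
  congr 2
  omega

theorem subsingleton_setOf_pow_eq_of_le (T : Equiv.Perm ℝ) (a b d : ℝ) :
    {x | x ∈ Ioo a b ∧ ∃ j, (∀ i, 0 < i → i ≤ j → (T ^ i) x ∉ Ico a b) ∧
      (T ^ j) x = d}.Subsingleton := by
  have key : ∀ x y : ℝ, ∀ j j' : ℕ, x ∈ Ioo a b → (T ^ j) x = (T ^ j') y → j ≤ j' →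
      (∀ i, 0 < i → i ≤ j' → (T ^ i) y ∉ Ico a b) → x = y := by
    intro x y j j' hx he hj h
    have h1 := pow_apply_eq_pow_sub hj he
    rcases Nat.eq_zero_or_pos (j' - j) with h0 | h0
    · simpa [h0] using h1
    · exact absurd (h1 ▸ Ioo_subset_Ico_self hx) (h _ h0 (by omega))
  rintro x ⟨hx, j, h, he⟩ y ⟨hy, j', h', he'⟩
  rcases le_total j j' with hj | hj
  · exact key x y j j' hx (he.trans he'.symm) hj h'
  · exact (key y x j' j hy (he'.trans he.symm) hj h).symm

theorem subsingleton_setOf_pow_eq_of_lt (T : Equiv.Perm ℝ) (a b d : ℝ) :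
    {x | x ∈ Ioo a b ∧ ∃ j, 0 < j ∧ (∀ i, 0 < i → i < j → (T ^ i) x ∉ Ico a b) ∧
      (T ^ j) x = d}.Subsingleton := by
  have key : ∀ x y : ℝ, ∀ j j' : ℕ, 0 < j → x ∈ Ioo a b → (T ^ j) x = (T ^ j') y → j ≤ j' →
      (∀ i, 0 < i → i < j' → (T ^ i) y ∉ Ico a b) → x = y := by
    intro x y j j' h0 hx he hj h
    have h1 := pow_apply_eq_pow_sub hj he
    rcases Nat.eq_zero_or_pos (j' - j) with h0 | h0
    · simpa [h0] using h1
    · exact absurd (h1 ▸ Ioo_subset_Ico_self hx) (h _ h0 (by omega))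
  rintro x ⟨hx, j, h0, h, he⟩ y ⟨hy, j', h0', h', he'⟩
  rcases le_total j j' with hj | hj
  · exact key x y j j' h0 hx (he.trans he'.symm) hj h'
  · exact (key y x j' j h0' hy (he'.trans he.symm) hj h).symm

theorem allCuts_subset_biUnion (T : Equiv.Perm ℝ) (D : Finset ℝ) (a b : ℝ) :
    allCuts T D a b ⊆
      (⋃ d ∈ D, {x | x ∈ Ioo a b ∧ ∃ j, (∀ i, 0 < i → i ≤ j → (T ^ i) x ∉ Ico a b) ∧
        (T ^ j) x = d}) ∪
      ⋃ d ∈ ({a, b} : Finset ℝ), {x | x ∈ Ioo a b ∧ ∃ j, 0 < j ∧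
        (∀ i, 0 < i → i < j → (T ^ i) x ∉ Ico a b) ∧ (T ^ j) x = d} := by
  refine iUnion_subset fun k => ?_
  rintro x ⟨hx, ⟨j, hj, h1, h2⟩ | ⟨j, hj0, hj, h1, h2⟩⟩
  · left
    simp only [mem_iUnion]
    exact ⟨_, h2, hx, j, h1, rfl⟩
  · right
    simp only [mem_iUnion]
    exact ⟨(T ^ j) x, by simpa using h2, hx, j, hj0, h1, rfl⟩

theorem allCuts_finite (T : Equiv.Perm ℝ) (D : Finset ℝ) (a b : ℝ) :
    (allCuts T D a b).Finite := by
  refine Set.Finite.subset (Set.Finite.union ?_ ?_) (allCuts_subset_biUnion T D a b)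
  · exact D.finite_toSet.biUnion fun d _ => (subsingleton_setOf_pow_eq_of_le T a b d).finite
  · exact (Finset.finite_toSet _).biUnion fun d _ =>
      (subsingleton_setOf_pow_eq_of_lt T a b d).finite

theorem ncard_allCuts_le (T : Equiv.Perm ℝ) (D : Finset ℝ) (a b : ℝ) :
    (allCuts T D a b).ncard ≤ D.card + 2 := by
  have h1 : ∀ (F : Finset ℝ) (f : ℝ → Set ℝ), (∀ d, (f d).Subsingleton) →
      (⋃ d ∈ F, f d).ncard ≤ F.card := by
    intro F f hf
    refine (Finset.set_ncard_biUnion_le F f).trans ?_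
    refine (Finset.sum_le_card_nsmul F _ 1 fun d _ => ?_).trans (by simp)
    exact (Set.ncard_le_one (hf d).finite).2 fun x hx y hy => hf d hx hy
  refine (Set.ncard_le_ncard (allCuts_subset_biUnion T D a b) (Set.Finite.union ?_ ?_)).trans
    ((Set.ncard_union_le _ _).trans (add_le_add ?_ ?_))
  · exact D.finite_toSet.biUnion fun d _ => (subsingleton_setOf_pow_eq_of_le T a b d).finite
  · exact (Finset.finite_toSet _).biUnion fun d _ =>
      (subsingleton_setOf_pow_eq_of_lt T a b d).finite
  · exact h1 _ _ fun d => subsingleton_setOf_pow_eq_of_le T a b d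
  · exact (h1 _ _ fun d => subsingleton_setOf_pow_eq_of_lt T a b d).trans Finset.card_le_two

theorem exists_mem_insert_forall_Ioc_notMem {S : Set ℝ} (hS : S.Finite) {a z : ℝ} (h : a ≤ z) :
    ∃ p ∈ insert a S, a ≤ p ∧ p ≤ z ∧ ∀ x ∈ Ioc p z, x ∉ S := by
  have hf : (insert a S ∩ Icc a z).Finite := (hS.insert a).inter_of_left _
  obtain ⟨p, hp, hmax⟩ := hf.exists_maximal ⟨a, mem_insert _ _, le_refl a, h⟩
  refine ⟨p, hp.1, hp.2.1, hp.2.2, fun x hx hxS => ?_⟩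
  exact absurd (hmax ⟨mem_insert_of_mem _ hxS, hp.2.1.trans hx.1.le, hx.2⟩ hx.1.le)
    (not_le.2 hx.1)

theorem exists_mem_insert_forall_Ioo_notMem {S : Set ℝ} (hS : S.Finite) {b z : ℝ} (h : z < b) :
    ∃ q ∈ insert b S, z < q ∧ q ≤ b ∧ ∀ x ∈ Ioo z q, x ∉ S := by
  have hf : (insert b S ∩ Ioc z b).Finite := (hS.insert b).inter_of_left _
  obtain ⟨q, hq, hmin⟩ := hf.exists_minimal ⟨b, mem_insert _ _, h, le_refl b⟩
  refine ⟨q, hq.1, hq.2.1, hq.2.2, fun x hx hxS => ?_⟩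
  exact absurd (hmin ⟨mem_insert_of_mem _ hxS, hx.1, hx.2.le.trans hq.2.2⟩ hx.2.le)
    (not_le.2 hx.2)

theorem returnTime_spec {T : Equiv.Perm ℝ} {I : Set ℝ} {z : ℝ} (h : ∃ n, 0 < n ∧ (T ^ n) z ∈ I) :
    0 < returnTime T I z ∧ (T ^ returnTime T I z) z ∈ I := Nat.sInf_mem h

theorem returnTime_le {T : Equiv.Perm ℝ} {I : Set ℝ} {z : ℝ} {n : ℕ} (h0 : 0 < n)
    (h : (T ^ n) z ∈ I) : returnTime T I z ≤ n := Nat.sInf_le ⟨h0, h⟩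

theorem notMem_of_lt_returnTime {T : Equiv.Perm ℝ} {I : Set ℝ} {z : ℝ} {n : ℕ} (h0 : 0 < n)
    (h : n < returnTime T I z) : (T ^ n) z ∉ I :=
  fun hn => absurd (returnTime_le h0 hn) (not_le.2 h)

theorem returnTime_eq_of_first {T : Equiv.Perm ℝ} {I : Set ℝ} {z : ℝ} {n : ℕ} (h0 : 0 < n)
    (h : (T ^ n) z ∈ I) (hf : ∀ i, 0 < i → i < n → (T ^ i) z ∉ I) : returnTime T I z = n := by
  refine le_antisymm (returnTime_le h0 h) (not_lt.1 fun hlt => ?_)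
  have := returnTime_spec ⟨n, h0, h⟩
  exact hf _ this.1 hlt this.2

namespace PiecewiseTranslation

variable {T : Equiv.Perm ℝ} {l r : ℝ} {D : Finset ℝ}

theorem mem_iff (h : PiecewiseTranslation T l r D) (z : ℝ) : T z ∈ Ico l r ↔ z ∈ Ico l r := by
  constructor
  · intro hz
    by_contra hn
    rw [h.fix z hn] at hz
    exact hn hz
  · intro hz
    by_contra hn
    have := T.injective (h.fix _ hn)
    rw [this] at hn
    exact hn hz

theorem pow_mem_iff (h : PiecewiseTranslation T l r D) (k : ℕ) (z : ℝ) :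
    (T ^ k) z ∈ Ico l r ↔ z ∈ Ico l r := by
  induction k with
  | zero => simp
  | succ k ih => rw [pow_succ', Equiv.Perm.mul_apply, h.mem_iff, ih]

theorem zpow_mem_iff (h : PiecewiseTranslation T l r D) (k : ℤ) (z : ℝ) :
    (T ^ k) z ∈ Ico l r ↔ z ∈ Ico l r := by
  obtain ⟨n, rfl | rfl⟩ := k.eq_nat_or_neg
  · rw [zpow_natCast, h.pow_mem_iff]
  · rw [← h.pow_mem_iff n, zpow_neg, zpow_natCast, perm_apply_inv_apply]

theorem pow_trans (h : PiecewiseTranslation T l r D) {w w' : ℝ} (hl : l ≤ w) (hr : w' < r) (k : ℕ)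
    (hc : ∀ x ∈ Ioc w w', ∀ j < k, (T ^ j) x ∉ D) :
    ∀ x ∈ Icc w w', (T ^ k) x - x = (T ^ k) w - w := by
  induction k with
  | zero => simp
  | succ k ih =>
    have ih' := ih fun x hx j hj => hc x hx j (by omega)
    intro x hx
    have hx1 := ih' x hx
    have hwX : (T ^ k) w ∈ Ico l r :=
      (h.pow_mem_iff k w).2 ⟨hl, lt_of_le_of_lt (hx.1.trans hx.2) hr⟩
    have hxX : (T ^ k) x ∈ Ico l r :=
      (h.pow_mem_iff k x).2 ⟨hl.trans hx.1, lt_of_le_of_lt hx.2 hr⟩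
    have := h.trans ((T ^ k) w) ((T ^ k) x) hwX.1 (by linarith [hx.1]) hxX.2 (by
      intro d hd hdD
      have hm : w + (d - (T ^ k) w) ∈ Ioc w w' :=
        ⟨by linarith [hd.1], by linarith [hd.2, hx.2]⟩
      have h2 := ih' _ (Ioc_subset_Icc_self hm)
      apply hc _ hm k (by omega)
      have : (T ^ k) (w + (d - (T ^ k) w)) = d := by linarith
      rwa [this])
    rw [pow_succ', Equiv.Perm.mul_apply, Equiv.Perm.mul_apply]
    linarith

theorem pow_trans_of_notMem_cutSet (h : PiecewiseTranslation T l r D) {a b w w' : ℝ} (ha : l ≤ a)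
    (hb : b ≤ r) (hw : a ≤ w) (hw' : w' < b) (k : ℕ)
    (hret : ∀ i, 0 < i → i < k → (T ^ i) w ∉ Ico a b)
    (hc : ∀ x ∈ Ioc w w', x ∉ cutSet T D a b k) :
    ∀ x ∈ Icc w w', (T ^ k) x - x = (T ^ k) w - w ∧
      ∀ i, 0 < i → i ≤ k → ((T ^ i) x ∈ Ico a b ↔ (T ^ i) w ∈ Ico a b) := by
  induction k with
  | zero => intro x _; exact ⟨by simp, fun i h1 h2 => by omega⟩
  | succ k ih =>
    have ih' := ih (fun i h1 h2 => hret i h1 (by omega))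
      (fun x hx hx' => hc x hx (cutSet_mono T D a b (Nat.le_succ k) hx'))
    have hIoo : ∀ x ∈ Ioc w w', x ∈ Ioo a b := fun x hx =>
      ⟨lt_of_le_of_lt hw hx.1, lt_of_le_of_lt hx.2 hw'⟩
    have hno : ∀ x ∈ Icc w w', ∀ i, 0 < i → i < k + 1 → (T ^ i) x ∉ Ico a b := by
      intro x hx i h1 h2
      rw [(ih' x hx).2 i h1 (by omega)]
      exact hret i h1 h2
    have htr : ∀ x ∈ Icc w w', (T ^ (k + 1)) x - x = (T ^ (k + 1)) w - w := by
      intro x hx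
      have hx1 := (ih' x hx).1
      have hwX : (T ^ k) w ∈ Ico l r :=
        (h.pow_mem_iff k w).2 ⟨by linarith, by linarith [hx.1, hx.2]⟩
      have hxX : (T ^ k) x ∈ Ico l r :=
        (h.pow_mem_iff k x).2 ⟨by linarith [hx.1], by linarith [hx.1, hx.2]⟩
      have := h.trans ((T ^ k) w) ((T ^ k) x) hwX.1 (by linarith [hx.1]) hxX.2 (by
        intro d hd hdD
        have hm : w + (d - (T ^ k) w) ∈ Ioc w w' :=
          ⟨by linarith [hd.1], by linarith [hd.2, hx.2]⟩
        have h2 := (ih' _ (Ioc_subset_Icc_self hm)).1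
        have h3 : (T ^ k) (w + (d - (T ^ k) w)) = d := by linarith
        refine hc _ hm ⟨hIoo _ hm, Or.inl ⟨k, by omega, fun i h1 h2 => ?_, by rwa [h3]⟩⟩
        exact hno _ (Ioc_subset_Icc_self hm) i h1 (by omega))
      rw [pow_succ', Equiv.Perm.mul_apply, Equiv.Perm.mul_apply]
      linarith
    have hcross : ∀ x ∈ Icc w w', ∀ c, (c = a ∨ c = b) →
        (c ≤ (T ^ (k + 1)) x ↔ c ≤ (T ^ (k + 1)) w) := by
      intro x hx c hcab
      have hx1 := htr x hx
      refine ⟨fun hcx => not_lt.1 fun hcw => ?_, fun hcw => by linarith [hx.1]⟩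
      have hm : w + (c - (T ^ (k + 1)) w) ∈ Ioc w w' := ⟨by linarith, by linarith [hx.2]⟩
      have h2 := htr _ (Ioc_subset_Icc_self hm)
      have h3 : (T ^ (k + 1)) (w + (c - (T ^ (k + 1)) w)) = c := by linarith
      refine hc _ hm ⟨hIoo _ hm, Or.inr ⟨k + 1, by omega, le_rfl, ?_, ?_⟩⟩
      · exact hno _ (Ioc_subset_Icc_self hm)
      · rwa [h3]
    intro x hx
    refine ⟨htr x hx, fun i h1 h2 => ?_⟩
    rcases Nat.lt_or_ge i (k + 1) with h3 | h3
    · exact (ih' x hx).2 i h1 (by omega)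
    · obtain rfl : i = k + 1 := by omega
      have e1 := hcross x hx a (Or.inl rfl)
      have e2 := hcross x hx b (Or.inr rfl)
      simp only [mem_Ico, e1, ← not_le, e2]

theorem exists_return (h : PiecewiseTranslation T l r D) {a b z : ℝ} (ha : l ≤ a) (hb : b ≤ r)
    (hz : z ∈ Ico a b) : ∃ n, 0 < n ∧ (T ^ n) z ∈ Ico a b := by
  by_contra! hno
  obtain ⟨q, -, hzq, hqb, hq⟩ := exists_mem_insert_forall_Ioo_notMem (allCuts_finite T D a b) hz.2
  have hnever : ∀ i, 0 < i → ∀ x ∈ Ico z q, (T ^ i) x ∉ Ico a b := by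
    intro i hi x hx
    have := (h.pow_trans_of_notMem_cutSet ha hb hz.1 (hx.2.trans_le hqb) i
      (fun j hj _ => hno j hj) (fun y hy hy' => hq y ⟨hy.1, hy.2.trans_lt hx.2⟩
        (cutSet_subset_allCuts T D a b i hy')) x ⟨hx.1, le_rfl⟩).2 i hi le_rfl
    rw [this]
    exact hno i hi
  obtain ⟨n, hn⟩ := exists_nat_gt ((r - l) / (q - z))
  have := h.wander z q n (ha.trans hz.1) hzq (hqb.trans hb) fun i hi _ x hx hx' =>
    hnever i hi x hx ⟨hz.1.trans hx'.1, hx'.2.trans_le hqb⟩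
  rw [div_lt_iff₀ (by linarith)] at hn
  linarith

theorem returnTime_const (h : PiecewiseTranslation T l r D) {a b w w' : ℝ} (ha : l ≤ a)
    (hb : b ≤ r) (hw : a ≤ w) (hww' : w ≤ w') (hw' : w' < b)
    (hc : ∀ x ∈ Ioc w w', x ∉ allCuts T D a b) :
    returnTime T (Ico a b) w' = returnTime T (Ico a b) w ∧
      inducedMap T (Ico a b) w' - w' = inducedMap T (Ico a b) w - w := by
  have hw1 := returnTime_spec (h.exists_return ha hb (z := w) ⟨hw, hww'.trans_lt hw'⟩)
  have key := h.pow_trans_of_notMem_cutSet ha hb hw hw' (returnTime T (Ico a b) w)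
    (fun i h1 h2 => notMem_of_lt_returnTime h1 h2)
    (fun x hx hx' => hc x hx (cutSet_subset_allCuts T D a b _ hx')) w' ⟨hww', le_rfl⟩
  have he : returnTime T (Ico a b) w' = returnTime T (Ico a b) w := by
    refine returnTime_eq_of_first hw1.1 ((key.2 _ hw1.1 le_rfl).2 hw1.2) fun i h1 h2 => ?_
    rw [key.2 i h1 h2.le]
    exact notMem_of_lt_returnTime h1 h2
  refine ⟨he, ?_⟩
  unfold inducedMap
  rw [he]
  exact key.1

theorem exists_returnTime_eq (h : PiecewiseTranslation T l r D) {a b z : ℝ} (ha : l ≤ a)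
    (hb : b ≤ r) (hz : z ∈ Ico a b) :
    ∃ x ∈ insert a (allCuts T D a b), returnTime T (Ico a b) z = returnTime T (Ico a b) x := by
  obtain ⟨p, hp, hap, hpz, hc⟩ :=
    exists_mem_insert_forall_Ioc_notMem (allCuts_finite T D a b) hz.1
  exact ⟨p, hp, (h.returnTime_const ha hb hap hpz hz.2 hc).1⟩

theorem finite_returnTimes (h : PiecewiseTranslation T l r D) {a b : ℝ} (ha : l ≤ a)
    (hb : b ≤ r) : (returnTime T (Ico a b) '' Ico a b).Finite := by
  refine Set.Finite.subset (((allCuts_finite T D a b).insert a).image (returnTime T (Ico a b))) ?_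
  rintro _ ⟨z, hz, rfl⟩
  obtain ⟨x, hx, he⟩ := h.exists_returnTime_eq ha hb hz
  exact ⟨x, hx, he.symm⟩

theorem ncard_returnTimes_le (h : PiecewiseTranslation T l r D) {a b : ℝ} (ha : l ≤ a)
    (hb : b ≤ r) : (returnTime T (Ico a b) '' Ico a b).ncard ≤ D.card + 3 := by
  have hfin := (allCuts_finite T D a b).insert a
  have hsub : returnTime T (Ico a b) '' Ico a b ⊆
      returnTime T (Ico a b) '' insert a (allCuts T D a b) := by
    rintro _ ⟨z, hz, rfl⟩
    obtain ⟨x, hx, he⟩ := h.exists_returnTime_eq ha hb hz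
    exact ⟨x, hx, he.symm⟩
  refine (Set.ncard_le_ncard hsub (hfin.image _)).trans ((Set.ncard_image_le hfin).trans
    ((Set.ncard_insert_le _ _).trans ?_))
  have := ncard_allCuts_le T D a b
  omega

theorem inv (h : PiecewiseTranslation T l r D) :
    PiecewiseTranslation T⁻¹ l r ((insert l D).image T) where
  fix z hz := by rw [Equiv.Perm.inv_eq_iff_eq, h.fix z hz]
  trans y y' hy hyy' hy' hc := by
    have hw' : T⁻¹ y' ∈ Ico l r := by
      rw [← h.mem_iff, perm_apply_inv_apply]
      exact ⟨hy.trans hyy', hy'⟩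
    obtain ⟨g, hg, hlg, hgw, hgc⟩ :=
      exists_mem_insert_forall_Ioc_notMem D.finite_toSet hw'.1
    have hgD : T g ∈ (insert l D).image T := by
      refine Finset.mem_image_of_mem _ ?_
      simpa using hg
    have e1 := h.trans g (T⁻¹ y') hlg hgw hw'.2 hgc
    rw [perm_apply_inv_apply] at e1
    have hgy : T g ≤ y := not_lt.1 fun hlt => hc (T g) ⟨hlt, by linarith⟩ hgD
    have e2 := h.trans g (g + (y - T g)) hlg (by linarith) (by linarith [hw'.2])
      fun x hx => hgc x ⟨hx.1, by linarith [hx.2]⟩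
    have e3 : T⁻¹ y = g + (y - T g) := by
      rw [Equiv.Perm.inv_eq_iff_eq]
      linarith
    linarith
  wander p q n hp hpq hq hno := h.wander p q n hp hpq hq fun i hi hin z hz hz' =>
    hno i hi hin _ hz' (by rwa [inv_pow, perm_inv_apply_apply])

end PiecewiseTranslation

/-- A piecewise translation whose division points satisfy the infinite distinct orbit condition,
one of them being mapped to the left endpoint. -/
structure RegularTranslation (T : Equiv.Perm ℝ) (l r : ℝ) (D : Finset ℝ) : Prop extends
    PiecewiseTranslation T l r D where
  lt : l < r
  sub : ∀ x ∈ D, x ∈ Ioo l r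
  reg : ∀ x ∈ D, ∀ y ∈ D, ∀ n : ℤ, (T ^ n) x = y → n = 0
  start : ∃ x ∈ D, T x = l

/-- `p` lies on the orbit of a point of `D`, at time at most `n` in absolute value. -/
def NearOrbit (T : Equiv.Perm ℝ) (D : Finset ℝ) (n : ℕ) (p : ℝ) : Prop :=
  ∃ x ∈ D, ∃ m : ℤ, |m| ≤ n ∧ p = (T ^ m) x

theorem NearOrbit.mono {T : Equiv.Perm ℝ} {D : Finset ℝ} {n n' : ℕ} {p : ℝ} (hn : n ≤ n')
    (h : NearOrbit T D n p) : NearOrbit T D n' p := by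
  obtain ⟨x, hx, m, hm, he⟩ := h
  exact ⟨x, hx, m, hm.trans (by exact_mod_cast hn), he⟩

theorem NearOrbit.zpow {T : Equiv.Perm ℝ} {D : Finset ℝ} {n n' : ℕ} {p : ℝ} {k : ℤ}
    (h : NearOrbit T D n p) (hk : |k| ≤ n') : NearOrbit T D (n + n') ((T ^ k) p) := by
  obtain ⟨x, hx, m, hm, rfl⟩ := h
  refine ⟨x, hx, k + m, ?_, by rw [zpow_add, Equiv.Perm.mul_apply]⟩
  push_cast
  linarith [abs_add_le k m]

theorem NearOrbit.of_pow {T : Equiv.Perm ℝ} {D : Finset ℝ} {n n' : ℕ} {p : ℝ} {k : ℕ}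
    (h : NearOrbit T D n ((T ^ k) p)) (hk : k ≤ n') : NearOrbit T D (n + n') p := by
  have := h.zpow (k := -(k : ℤ)) (n' := n') (by rw [abs_neg, Nat.abs_cast]; exact_mod_cast hk)
  rwa [zpow_neg, zpow_natCast, perm_inv_apply_apply] at this

theorem nearOrbit_zero {T : Equiv.Perm ℝ} {D : Finset ℝ} {p : ℝ} (h : p ∈ D) :
    NearOrbit T D 0 p := ⟨p, h, 0, by simp, by simp⟩

theorem finite_setOf_pow_mem (T : Equiv.Perm ℝ) (D : Finset ℝ) (k : ℕ) :
    {x | ∃ j < k, (T ^ j) x ∈ D}.Finite := by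
  have : {x | ∃ j < k, (T ^ j) x ∈ D} = ⋃ j ∈ Finset.range k, (T ^ j) ⁻¹' (D : Set ℝ) := by
    ext x
    simp
  rw [this]
  exact (Finset.finite_toSet _).biUnion fun j _ =>
    D.finite_toSet.preimage ((T ^ j).injective.injOn)

namespace RegularTranslation

variable {T : Equiv.Perm ℝ} {l r : ℝ} {D : Finset ℝ}

theorem pow_ne_self (h : RegularTranslation T l r D) {y : ℝ} (hy : y ∈ Ico l r) {p : ℕ}
    (hp : 0 < p) : (T ^ p) y ≠ y := by
  intro hper
  obtain ⟨a, ha, hla, hay, hc⟩ :=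
    exists_mem_insert_forall_Ioc_notMem (finite_setOf_pow_mem T D p) hy.1
  have h1 := h.pow_trans hla hy.2 p (fun x hx j hj hD => hc x hx ⟨j, hj, hD⟩) y ⟨hay, le_rfl⟩
  have h2 : (T ^ (p : ℤ)) a = a := by
    rw [zpow_natCast]
    linarith
  have h3 : ∃ d ∈ D, ∃ m : ℤ, a = (T ^ m) d := by
    rcases ha with rfl | ⟨j, -, hD⟩
    · obtain ⟨x, hx, he⟩ := h.start
      exact ⟨x, hx, 1, by simp [he]⟩
    · exact ⟨_, hD, -j, by rw [zpow_neg, zpow_natCast, perm_inv_apply_apply]⟩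
  obtain ⟨d, hd, m, rfl⟩ := h3
  have h4 : (T ^ (p : ℤ)) d = d := by
    apply (T ^ m).injective
    rwa [← Equiv.Perm.mul_apply, ← zpow_add, add_comm, zpow_add, Equiv.Perm.mul_apply]
  have := h.reg d hd d hd p h4
  omega

theorem pow_injective (h : RegularTranslation T l r D) {y : ℝ} (hy : y ∈ Ico l r) :
    Function.Injective fun p : ℕ => (T ^ p) y := by
  intro p q hpq
  wlog hle : p ≤ q generalizing p q
  · exact (this hpq.symm (by omega)).symm
  by_contra hne
  exact h.pow_ne_self hy (p := q - p) (by omega) (pow_apply_eq_pow_sub hle hpq).symm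

theorem inv_pow_injective (h : RegularTranslation T l r D) {y : ℝ} (hy : y ∈ Ico l r) :
    Function.Injective fun p : ℕ => (T⁻¹ ^ p) y := by
  intro p q hpq
  wlog hle : p ≤ q generalizing p q
  · exact (this hpq.symm (by omega)).symm
  by_contra hne
  have h1 := pow_apply_eq_pow_sub hle hpq
  refine h.pow_ne_self hy (p := q - p) (by omega) ?_
  conv_lhs => rw [h1]
  rw [inv_pow, perm_apply_inv_apply]

theorem map_nhds (h : RegularTranslation T l r D) {w : ℝ} (hw : w ∈ Ioo l r) (hD : w ∉ D) :
    Filter.map T (nhds w) = nhds (T w) := by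
  have h1 : Ioo l r ∩ (D : Set ℝ)ᶜ ∈ nhds w :=
    Filter.inter_mem (Ioo_mem_nhds hw.1 hw.2) (D.finite_toSet.isClosed.isOpen_compl.mem_nhds hD)
  obtain ⟨ε, hε, hball⟩ := Metric.mem_nhds_iff.1 h1
  rw [Real.ball_eq_Ioo] at hball
  have h2 : T =ᶠ[nhds w] fun x => x + (T w - w) := by
    filter_upwards [Ioo_mem_nhds (sub_lt_self w hε) (lt_add_of_pos_right w hε)] with x hx
    rcases le_total x w with hxw | hxw
    · have := h.trans x w (hball hx).1.1.le hxw hw.2 fun y hy =>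
        (hball ⟨hx.1.trans hy.1, hy.2.trans_lt (by linarith)⟩).2
      linarith
    · have := h.trans w x hw.1.le hxw (hball hx).1.2 fun y hy =>
        (hball ⟨by linarith [hy.1], hy.2.trans_lt hx.2⟩).2
      linarith
  rw [Filter.map_congr h2, map_add_right_nhds]
  congr 1
  ring

theorem apply_mem_Ioo (h : RegularTranslation T l r D) {w : ℝ} (hw : w ∈ Ioo l r) (hD : w ∉ D) :
    T w ∈ Ioo l r := by
  have hX : T w ∈ Ico l r := (h.mem_iff w).2 (Ioo_subset_Ico_self hw)
  refine ⟨lt_of_le_of_ne hX.1 fun he => ?_, hX.2⟩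
  obtain ⟨x, hx, hxl⟩ := h.start
  rw [he, T.apply_eq_iff_eq] at hxl
  exact hD (hxl ▸ hx)

theorem mem_frontier_image_iff (h : RegularTranslation T l r D) (Z : Set ℝ) {w : ℝ}
    (hw : w ∈ Ioo l r) (hD : w ∉ D) : T w ∈ frontier (T '' Z) ↔ w ∈ frontier Z := by
  rw [frontier_eq_closure_inter_closure, frontier_eq_closure_inter_closure, mem_inter_iff,
    mem_inter_iff, mem_closure_iff_frequently, mem_closure_iff_frequently,
    mem_closure_iff_frequently, mem_closure_iff_frequently, ← h.map_nhds hw hD,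
    Filter.frequently_map, Filter.frequently_map]
  simp only [mem_compl_iff, T.injective.mem_set_image]

theorem finite_frontier_image (h : RegularTranslation T l r D) {Z : Set ℝ}
    (hZ : (frontier Z ∩ Ioo l r).Finite) : (frontier (T '' Z) ∩ Ioo l r).Finite := by
  refine Set.Finite.subset ((hZ.union (D.finite_toSet.insert l)).image T) ?_
  rintro y ⟨hy, hyI⟩
  refine ⟨T⁻¹ y, ?_, perm_apply_inv_apply T y⟩
  have hX : T⁻¹ y ∈ Ico l r := by
    rw [← h.mem_iff, perm_apply_inv_apply]
    exact Ioo_subset_Ico_self hyI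
  by_cases hl : T⁻¹ y = l
  · exact Or.inr (Or.inl hl)
  by_cases hD : T⁻¹ y ∈ D
  · exact Or.inr (Or.inr hD)
  have hI : T⁻¹ y ∈ Ioo l r := ⟨lt_of_le_of_ne hX.1 (Ne.symm hl), hX.2⟩
  refine Or.inl ⟨(h.mem_frontier_image_iff Z hI hD).1 ?_, hI⟩
  rwa [perm_apply_inv_apply]

theorem finite_frontier_biUnion (h : RegularTranslation T l r D) {a b : ℝ} (hab : a < b) (H : ℕ) :
    (frontier (⋃ k ∈ Finset.range H, (T ^ k) '' Ico a b) ∩ Ioo l r).Finite := by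
  have h1 : ∀ k : ℕ, (frontier ((T ^ k) '' Ico a b) ∩ Ioo l r).Finite := by
    intro k
    induction k with
    | zero =>
      refine Set.Finite.subset (Set.toFinite {a, b}) ?_
      rw [pow_zero, Equiv.Perm.coe_one, image_id, frontier_Ico hab]
      exact inter_subset_left
    | succ k ih =>
      have := h.finite_frontier_image ih
      rwa [← image_comp, ← Equiv.Perm.coe_mul, ← pow_succ'] at this
  induction H with
  | zero => simp
  | succ H ih =>
    rw [Finset.range_add_one, Finset.set_biUnion_insert]
    refine Set.Finite.subset ((h1 H).union ih) ?_
    rintro x ⟨hx, hI⟩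
    rcases frontier_union_subset _ _ hx with hx | hx
    · exact Or.inl ⟨hx.1, hI⟩
    · exact Or.inr ⟨hx.2, hI⟩

theorem frontier_inter_eq_empty_of_image_eq (h : RegularTranslation T l r D) {Y : Set ℝ}
    (hY : T '' Y = Y) (hfin : (frontier Y ∩ Ioo l r).Finite) : frontier Y ∩ Ioo l r = ∅ := by
  by_contra hne
  obtain ⟨y, hy⟩ := nonempty_iff_ne_empty.2 hne
  have hyX := Ioo_subset_Ico_self hy.2
  have hp : ∃ p : ℕ, (T ^ p) y ∈ D := by
    by_contra! hno
    have hall : ∀ p : ℕ, (T ^ p) y ∈ frontier Y ∩ Ioo l r := by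
      intro p
      induction p with
      | zero => simpa using hy
      | succ p ih =>
        have := (h.mem_frontier_image_iff Y ih.2 (hno p)).2 ih.1
        rw [hY] at this
        rw [pow_succ', Equiv.Perm.mul_apply]
        exact ⟨this, h.apply_mem_Ioo ih.2 (hno p)⟩
    exact Set.infinite_of_injective_forall_mem (h.pow_injective hyX) hall hfin
  have hq : ∃ q : ℕ, 0 < q ∧ (T⁻¹ ^ q) y ∈ D := by
    by_contra! hno
    have hall : ∀ q : ℕ, (T⁻¹ ^ q) y ∈ frontier Y ∩ Ioo l r := by
      intro q
      induction q with
      | zero => simpa using hy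
      | succ q ih =>
        set w := (T⁻¹ ^ (q + 1)) y with hwdef
        have hTw : T w = (T⁻¹ ^ q) y := by
          rw [hwdef, pow_succ', Equiv.Perm.mul_apply, perm_apply_inv_apply]
        have hwD : w ∉ D := hno (q + 1) (by omega)
        have hwX : w ∈ Ico l r := by
          rw [← h.mem_iff, hTw]
          exact Ioo_subset_Ico_self ih.2
        have hwl : w ≠ l := by
          intro hl
          obtain ⟨x, hx, hxl⟩ := h.start
          refine hno (q + 2) (by omega) ?_
          rw [pow_succ', Equiv.Perm.mul_apply, ← hwdef, hl, ← hxl, perm_inv_apply_apply]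
          exact hx
        have hwI : w ∈ Ioo l r := ⟨lt_of_le_of_ne hwX.1 (Ne.symm hwl), hwX.2⟩
        refine ⟨(h.mem_frontier_image_iff Y hwI hwD).1 ?_, hwI⟩
        rw [hY, hTw]
        exact ih.1
    exact Set.infinite_of_injective_forall_mem (h.inv_pow_injective hyX) hall hfin
  obtain ⟨p, hp⟩ := hp
  obtain ⟨q, hq0, hq⟩ := hq
  have h0 := h.reg _ hq _ hp (p + q : ℕ) (by
    rw [zpow_natCast, pow_add, Equiv.Perm.mul_apply, inv_pow, perm_apply_inv_apply])
  omega

theorem exists_inv_pow_mem_of_returnTime_le (h : RegularTranslation T l r D) {a b : ℝ} {H : ℕ}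
    (ha : l ≤ a) (hab : a < b) (hb : b ≤ r)
    (hH : ∀ w ∈ Ico a b, returnTime T (Ico a b) w ≤ H) {z : ℝ} (hz : z ∈ Ico l r) :
    ∃ k < H, (T⁻¹ ^ k) z ∈ Ico a b := by
  set Y : Set ℝ := ⋃ k ∈ Finset.range H, (T ^ k) '' Ico a b with hYdef
  have hmem : ∀ y, y ∈ Y ↔ ∃ k < H, (T⁻¹ ^ k) y ∈ Ico a b := by
    intro y
    simp only [hYdef, mem_iUnion, Finset.mem_range, exists_prop, inv_pow]
    refine exists_congr fun k => and_congr_right fun _ => ?_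
    constructor
    · rintro ⟨w, hw, rfl⟩
      rwa [perm_inv_apply_apply]
    · intro hw
      exact ⟨_, hw, perm_apply_inv_apply _ _⟩
  have hret : ∀ w ∈ Ico a b, _ := fun w hw => returnTime_spec (h.exists_return ha hb hw)
  have hH0 : 0 < H := by
    have ha' : a ∈ Ico a b := ⟨le_rfl, hab⟩
    exact (hret a ha').1.trans_le (hH a ha')
  have hinv : T '' Y = Y := by
    apply Subset.antisymm
    · rintro _ ⟨y, hy, rfl⟩
      obtain ⟨k, hk, hw⟩ := (hmem y).1 hy
      rw [hmem]
      set w := (T⁻¹ ^ k) y with hwdef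
      have hy' : y = (T ^ k) w := by rw [hwdef, inv_pow, perm_apply_inv_apply]
      have hle : returnTime T (Ico a b) w ≤ H := hH w hw
      rcases Nat.lt_or_ge (k + 1) H with hk1 | hk1
      · refine ⟨k + 1, hk1, ?_⟩
        rwa [pow_succ, Equiv.Perm.mul_apply, perm_inv_apply_apply]
      · obtain ⟨i, hi⟩ : ∃ i, k + 1 = i + returnTime T (Ico a b) w :=
          ⟨k + 1 - returnTime T (Ico a b) w, by omega⟩
        refine ⟨i, by have := (hret w hw).1; omega, ?_⟩
        have : T y = (T ^ i) ((T ^ returnTime T (Ico a b) w) w) := by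
          rw [hy', ← Equiv.Perm.mul_apply, ← pow_succ', hi, pow_add, Equiv.Perm.mul_apply]
        rw [this, inv_pow, perm_inv_apply_apply]
        exact (hret w hw).2
    · intro y hy
      obtain ⟨k, hk, hw⟩ := (hmem y).1 hy
      refine ⟨T⁻¹ y, (hmem _).2 ?_, perm_apply_inv_apply T y⟩
      rcases Nat.eq_zero_or_pos k with rfl | hk0
      · rw [pow_zero, Equiv.Perm.one_apply] at hw
        have hex := h.inv.exists_return ha hb hw
        set n := returnTime T⁻¹ (Ico a b) y with hn
        have hspec := returnTime_spec hex
        rw [← hn] at hspec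
        have hfirst : returnTime T (Ico a b) ((T⁻¹ ^ n) y) = n := by
          refine returnTime_eq_of_first hspec.1 ?_ fun i hi hin hmi => ?_
          · rwa [inv_pow, perm_apply_inv_apply]
          · refine notMem_of_lt_returnTime (T := T⁻¹) (I := Ico a b) (z := y) (n := n - i)
              (by omega) (by omega) ?_
            have : (T ^ i) ((T⁻¹ ^ n) y) = (T⁻¹ ^ (n - i)) y := by
              rw [show n = i + (n - i) by omega, pow_add, Equiv.Perm.mul_apply, inv_pow,
                perm_apply_inv_apply]
              simp
            rwa [← this]
        refine ⟨n - 1, ?_, ?_⟩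
        · have := hH _ hspec.2
          omega
        · rw [← Equiv.Perm.mul_apply, ← pow_succ, Nat.sub_add_cancel hspec.1]
          exact hspec.2
      · refine ⟨k - 1, by omega, ?_⟩
        rw [← Equiv.Perm.mul_apply, ← pow_succ, Nat.sub_add_cancel hk0]
        exact hw
  have hempty := h.frontier_inter_eq_empty_of_image_eq hinv (h.finite_frontier_biUnion hab H)
  have hJ : Ico a b ⊆ Y := fun w hw => (hmem w).2 ⟨0, hH0, by simpa using hw⟩
  have hIoo : Ioo l r ⊆ Y := by
    have hclopen : IsPreconnected (Ioo l r) := isPreconnected_Ioo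
    rw [isPreconnected_iff_subset_of_disjoint] at hclopen
    have hsub : Ioo l r ⊆ interior Y ∪ interior Yᶜ := by
      intro x hx
      by_contra hn
      simp only [mem_union, not_or] at hn
      have : x ∈ frontier Y ∩ Ioo l r := by
        refine ⟨?_, hx⟩
        rw [interior_compl, notMem_compl_iff] at hn
        exact ⟨hn.2, hn.1⟩
      rw [hempty] at this
      exact this
    have hdisj : Ioo l r ∩ (interior Y ∩ interior Yᶜ) = ∅ := by
      rw [eq_empty_iff_forall_notMem]
      rintro x ⟨-, hx1, hx2⟩
      exact interior_subset hx2 (interior_subset hx1)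
    rcases hclopen _ _ isOpen_interior isOpen_interior hsub hdisj with hc | hc
    · exact hc.trans interior_subset
    · have hm : (a + b) / 2 ∈ Ioo l r := ⟨by linarith, by linarith⟩
      exact absurd (hJ ⟨by linarith, by linarith⟩ : (a + b) / 2 ∈ Y) (interior_subset (hc hm))
  rw [← hmem]
  rcases eq_or_lt_of_le hz.1 with rfl | hlz
  · obtain ⟨x, hx, hxl⟩ := h.start
    rw [← hinv, ← hxl]
    exact mem_image_of_mem T (hIoo (h.sub x hx))
  · exact hIoo ⟨hlz, hz.2⟩

theorem exists_pow_mem_of_returnTime_le (h : RegularTranslation T l r D) {a b : ℝ} {H : ℕ}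
    (ha : l ≤ a) (hab : a < b) (hb : b ≤ r)
    (hH : ∀ w ∈ Ico a b, returnTime T (Ico a b) w ≤ H) {z : ℝ} (hz : z ∈ Ico l r) :
    ∃ k, 0 < k ∧ k ≤ H ∧ (T ^ k) z ∈ Ico a b := by
  have hzH : (T ^ H) z ∈ Ico l r := (h.pow_mem_iff H z).2 hz
  obtain ⟨k, hk, hmem⟩ := h.exists_inv_pow_mem_of_returnTime_le ha hab hb hH hzH
  refine ⟨H - k, by omega, by omega, ?_⟩
  have : (T⁻¹ ^ k) ((T ^ H) z) = (T ^ (H - k)) z := by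
    conv_lhs => rw [show H = k + (H - k) by omega, pow_add, Equiv.Perm.mul_apply, inv_pow,
      perm_inv_apply_apply]
  rwa [← this]

end RegularTranslation

/-- Points of the orbits of `D` at times bounded by `n` are separated by at least `c / n`. -/
def OrbitGap (T : Equiv.Perm ℝ) (D : Finset ℝ) (c : ℝ) : Prop :=
  ∀ n : ℕ, 1 ≤ n → ∀ p q, NearOrbit T D n p → NearOrbit T D n q → p < q → c ≤ n * (q - p)

namespace RegularTranslation

variable {T : Equiv.Perm ℝ} {l r : ℝ} {D : Finset ℝ} {c : ℝ}

theorem nearOrbit_of_mem_cutSet {a b x : ℝ} {n t : ℕ} (ha : NearOrbit T D n a)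
    (hb : NearOrbit T D n b) (hx : x ∈ cutSet T D a b t) : NearOrbit T D (n + t) x := by
  obtain ⟨-, ⟨j, hj, -, hD⟩ | ⟨j, -, hj, -, he | he⟩⟩ := hx
  · exact ((nearOrbit_zero hD).of_pow hj.le).mono (by omega)
  · exact NearOrbit.of_pow (by rwa [he]) hj
  · exact NearOrbit.of_pow (by rwa [he]) hj

theorem nearOrbit_mem_Ico (h : RegularTranslation T l r D) {n : ℕ} {p : ℝ}
    (hp : NearOrbit T D n p) : p ∈ Ico l r := by
  obtain ⟨x, hx, m, -, rfl⟩ := hp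
  exact (h.zpow_mem_iff m x).2 (Ioo_subset_Ico_self (h.sub x hx))

theorem exists_returnTime_mem_Ioc (h : RegularTranslation T l r D) (hgap : OrbitGap T D c) {M : ℕ}
    (hM : 2 * (r - l) < c * M) {n t : ℕ} (hn : 1 ≤ n) (hnt : n ≤ t) {a b : ℝ}
    (ha : NearOrbit T D n a) (hb : NearOrbit T D n b) {z : ℝ} (hz : z ∈ Ico a b)
    (hzt : t < returnTime T (Ico a b) z) :
    ∃ w ∈ Ico a b, t < returnTime T (Ico a b) w ∧ returnTime T (Ico a b) w ≤ M * t := by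
  by_contra! hno
  have hla := (h.nearOrbit_mem_Ico ha).1
  have hbr := (h.nearOrbit_mem_Ico hb).2.le
  have hfin : (cutSet T D a b t).Finite :=
    (allCuts_finite T D a b).subset (cutSet_subset_allCuts T D a b t)
  obtain ⟨p, hp, hap, hpz, hpc⟩ := exists_mem_insert_forall_Ioc_notMem hfin hz.1
  obtain ⟨q, hq, hzq, hqb, hqc⟩ := exists_mem_insert_forall_Ioo_notMem hfin hz.2
  have hcut : ∀ x ∈ Ioo p q, x ∉ cutSet T D a b t := by
    intro x hx
    rcases le_or_gt x z with hxz | hxz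
    · exact hpc x ⟨hx.1, hxz⟩
    · exact hqc x ⟨hxz, hx.2⟩
  have hnear : ∀ y, (y = a ∨ y = b ∨ y ∈ cutSet T D a b t) → NearOrbit T D (n + t) y := by
    rintro y (rfl | rfl | hy)
    · exact ha.mono (by omega)
    · exact hb.mono (by omega)
    · exact nearOrbit_of_mem_cutSet ha hb hy
  have hpn : NearOrbit T D (n + t) p := hnear p (by rcases hp with hp | hp <;> tauto)
  have hqn : NearOrbit T D (n + t) q := hnear q (by rcases hq with hq | hq <;> tauto)
  have hpb : p < b := hpz.trans_lt hz.2
  have hpt : t < returnTime T (Ico a b) p := by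
    by_contra! hle
    have hspec := returnTime_spec (h.exists_return hla hbr ⟨hap, hpb⟩)
    have := (h.pow_trans_of_notMem_cutSet hla hbr hap hz.2 (returnTime T (Ico a b) p)
      (fun i h1 h2 => notMem_of_lt_returnTime h1 h2)
      (fun x hx hx' => hpc x hx (cutSet_mono T D a b hle hx')) z ⟨hpz, le_rfl⟩).2 _ hspec.1 le_rfl
    exact absurd (returnTime_le hspec.1 (this.2 hspec.2)) (by omega)
  have hlong : ∀ x ∈ Ico p q, M * t < returnTime T (Ico a b) x := by
    intro x hx
    have hxb : x < b := hx.2.trans_le hqb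
    refine hno x ⟨hap.trans hx.1, hxb⟩ ?_
    by_contra! hle
    have hspec := returnTime_spec (h.exists_return hla hbr ⟨hap.trans hx.1, hxb⟩)
    have := (h.pow_trans_of_notMem_cutSet hla hbr hap hxb t
      (fun i h1 h2 => notMem_of_lt_returnTime h1 (by omega))
      (fun y hy => hcut y ⟨hy.1, hy.2.trans_lt hx.2⟩) x ⟨hx.1, le_rfl⟩).2 _ hspec.1 hle
    exact notMem_of_lt_returnTime hspec.1 (by omega) (this.1 hspec.2)
  have h1 := h.wander p q (M * t) (hla.trans hap) (hpz.trans_lt hzq) (hqb.trans hbr)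
    fun i hi hit x hx hx' => notMem_of_lt_returnTime hi (hit.trans (hlong x hx))
      ⟨hap.trans hx'.1, hx'.2.trans_le hqb⟩
  have h2 := hgap (2 * t) (by omega) p q (hpn.mono (by omega)) (hqn.mono (by omega))
    (hpz.trans_lt hzq)
  push_cast at h1 h2
  have h3 : c * M ≤ 2 * t * (q - p) * M := mul_le_mul_of_nonneg_right h2 (Nat.cast_nonneg M)
  nlinarith

theorem exists_returnTime_le_mul (h : RegularTranslation T l r D) (hc : 0 < c)
    (hgap : OrbitGap T D c) : ∃ C : ℕ, 1 ≤ C ∧ ∀ n : ℕ, 1 ≤ n → ∀ a b, NearOrbit T D n a →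
      NearOrbit T D n b → a < b → ∀ z ∈ Ico a b, returnTime T (Ico a b) z ≤ C * n := by
  obtain ⟨M, hM⟩ := exists_nat_gt (2 * (r - l) / c)
  rw [div_lt_iff₀ hc, mul_comm _ c] at hM
  have hM1 : 1 ≤ M := by
    by_contra! h0
    obtain rfl : M = 0 := by omega
    have := h.lt
    simp only [Nat.cast_zero, mul_zero] at hM
    linarith
  refine ⟨M ^ (D.card + 4), Nat.one_le_pow _ _ hM1, fun n hn a b ha hb hab z hz => ?_⟩
  by_contra! hlt
  have hla := (h.nearOrbit_mem_Ico ha).1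
  have hbr := (h.nearOrbit_mem_Ico hb).2.le
  have hex : ∀ j ∈ Finset.range (D.card + 4), ∃ w ∈ Ico a b,
      M ^ j * n < returnTime T (Ico a b) w ∧ returnTime T (Ico a b) w ≤ M ^ (j + 1) * n := by
    intro j hj
    have hle : M ^ j * n ≤ M ^ (D.card + 4) * n :=
      Nat.mul_le_mul_right n (Nat.pow_le_pow_right hM1 (Finset.mem_range.1 hj).le)
    obtain ⟨w, hw, h1, h2⟩ := h.exists_returnTime_mem_Ioc hgap hM (t := M ^ j * n) hn
      (Nat.le_mul_of_pos_left n (Nat.pow_pos hM1)) ha hb hz (hle.trans_lt hlt)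
    exact ⟨w, hw, h1, h2.trans (by rw [pow_succ', mul_assoc])⟩
  choose! w hw hw1 hw2 using hex
  have hfin := h.finite_returnTimes hla hbr
  have hcard := h.ncard_returnTimes_le hla hbr
  rw [Set.ncard_eq_toFinset_card _ hfin] at hcard
  have := Finset.card_le_card_of_injOn (s := Finset.range (D.card + 4)) (t := hfin.toFinset)
    (fun j => returnTime T (Ico a b) (w j)) (fun j hj => by simpa using ⟨w j, hw j hj, rfl⟩) (by
      intro i hi j hj hij
      by_contra hne
      wlog hlt : i < j generalizing i j
      · exact this hj hi hij.symm (Ne.symm hne) (by omega)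
      have h1 := hw2 i hi
      have h2 := hw1 j hj
      have h3 : M ^ (i + 1) * n ≤ M ^ j * n :=
        Nat.mul_le_mul_right n (Nat.pow_le_pow_right hM1 hlt)
      simp only at hij
      omega)
  rw [Finset.card_range] at this
  omega

theorem exists_nearOrbit_sub_le (h : RegularTranslation T l r D) {n : ℕ} (hn : 1 ≤ n) :
    ∃ a b, NearOrbit T D n a ∧ NearOrbit T D n b ∧ a < b ∧ b - a ≤ (r - l) / n := by
  obtain ⟨x, hx, -⟩ := h.start
  have hxX := Ioo_subset_Ico_self (h.sub x hx)
  have hlr : 0 < r - l := sub_pos.2 h.lt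
  have hn0 : (0 : ℝ) < n := by exact_mod_cast hn
  have hX : ∀ k, (T ^ k) x ∈ Ico l r := fun k => (h.pow_mem_iff k x).2 hxX
  obtain ⟨i, hi, j, hj, hij, he⟩ := Finset.exists_ne_map_eq_of_card_lt_of_maps_to
    (s := Finset.range (n + 1)) (t := Finset.range n)
    (f := fun k => ⌊((T ^ k) x - l) * n / (r - l)⌋₊) (by simp) (by
      intro k _
      simp only [Finset.coe_range, mem_Iio]
      rw [Nat.floor_lt (div_nonneg (mul_nonneg (sub_nonneg.2 (hX k).1) hn0.le) hlr.le),
        div_lt_iff₀ hlr, mul_comm]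
      exact mul_lt_mul_of_pos_left (by linarith [(hX k).2]) hn0)
  have hne : (T ^ i) x ≠ (T ^ j) x := fun hh => hij (h.pow_injective hxX hh)
  simp only [Finset.mem_range] at hi hj
  wlog hlt : (T ^ i) x < (T ^ j) x generalizing i j
  · exact this j i hij.symm he.symm hne.symm hj hi (lt_of_le_of_ne (not_lt.1 hlt) hne.symm)
  refine ⟨_, _, ?_, ?_, hlt, ?_⟩
  · exact ⟨x, hx, i, by rw [Nat.abs_cast]; exact_mod_cast (by omega : i ≤ n), by simp⟩
  · exact ⟨x, hx, j, by rw [Nat.abs_cast]; exact_mod_cast (by omega : j ≤ n), by simp⟩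
  · have h1 := Nat.lt_floor_add_one (((T ^ j) x - l) * n / (r - l))
    have h2 := Nat.floor_le (a := ((T ^ i) x - l) * n / (r - l))
      (div_nonneg (mul_nonneg (sub_nonneg.2 (hX i).1) hn0.le) hlr.le)
    rw [he] at h2
    have h3 : ((T ^ j) x - l) * n / (r - l) - ((T ^ i) x - l) * n / (r - l) < 1 := by linarith
    rw [← sub_div, div_lt_one hlr] at h3
    rw [le_div_iff₀ hn0]
    linarith

theorem exists_nearOrbit_dense (h : RegularTranslation T l r D) (hc : 0 < c)
    (hgap : OrbitGap T D c) : ∃ C : ℕ, 1 ≤ C ∧ ∀ n : ℕ, 1 ≤ n → ∀ y ∈ Ico l r,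
      ∃ q, NearOrbit T D (C * n) q ∧ q ≤ y ∧ y - q ≤ (r - l) / n := by
  obtain ⟨C, hC1, hC⟩ := h.exists_returnTime_le_mul hc hgap
  refine ⟨C + 1, by omega, fun n hn y hy => ?_⟩
  obtain ⟨a, b, ha, hb, hab, hsub⟩ := h.exists_nearOrbit_sub_le hn
  have hla := (h.nearOrbit_mem_Ico ha).1
  have hbr := (h.nearOrbit_mem_Ico hb).2
  obtain ⟨k, hk, hz⟩ := h.exists_inv_pow_mem_of_returnTime_le hla hab hbr.le (hC n hn a b ha hb hab)
    hy
  set z := (T⁻¹ ^ k) y with hzdef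
  have hyz : (T ^ k) z = y := by rw [hzdef, inv_pow, perm_apply_inv_apply]
  obtain ⟨p, hp, hap, hpz, hcut⟩ :=
    exists_mem_insert_forall_Ioc_notMem (finite_setOf_pow_mem T D k) hz.1
  have h1 := h.pow_trans (hla.trans hap) (hz.2.trans hbr) k
    (fun x hx j hj hD => hcut x hx ⟨j, hj, hD⟩) z ⟨hpz, le_rfl⟩
  refine ⟨(T ^ k) p, ?_, by linarith, by linarith [hz.2]⟩
  rcases hp with rfl | ⟨j, hj, hD⟩
  · rw [← zpow_natCast]
    refine (ha.zpow (n' := C * n) (by rw [Nat.abs_cast]; exact_mod_cast hk.le)).mono (le_of_eq ?_)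
    ring
  · have he : (T ^ k) p = (T ^ (k - j)) ((T ^ j) p) := by
      rw [← Equiv.Perm.mul_apply, ← pow_add, Nat.sub_add_cancel hj.le]
    rw [he, ← zpow_natCast]
    refine ((nearOrbit_zero hD).zpow (n' := C * n) ?_).mono (by rw [add_mul]; omega)
    rw [Nat.abs_cast]
    exact_mod_cast (by omega : k - j ≤ C * n)

/-- Linear recurrence: hitting times of a semi-interval are at most inversely proportional to
its length. -/
theorem exists_hitting_le (h : RegularTranslation T l r D) (hc : 0 < c) (hgap : OrbitGap T D c) :
    ∃ C : ℝ, 0 < C ∧ ∀ u v, l ≤ u → u < v → v ≤ r → ∀ z ∈ Ico l r,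
      (∃ k : ℕ, k * (v - u) ≤ C ∧ (T⁻¹ ^ k) z ∈ Ioo u v) ∧
      ∃ k : ℕ, 0 < k ∧ k * (v - u) ≤ C ∧ (T ^ k) z ∈ Ioo u v := by
  obtain ⟨C, hC1, hC⟩ := h.exists_returnTime_le_mul hc hgap
  obtain ⟨C', hC1', hC'⟩ := h.exists_nearOrbit_dense hc hgap
  have hlr : 0 < r - l := sub_pos.2 h.lt
  have hCpos : (0 : ℝ) < C := by exact_mod_cast hC1
  have hCpos' : (0 : ℝ) < C' := by exact_mod_cast hC1'
  refine ⟨C * C' * (5 * (r - l)), by positivity, fun u v hu huv hv z hz => ?_⟩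
  have hε : 0 < v - u := sub_pos.2 huv
  set n := ⌈4 * (r - l) / (v - u)⌉₊ with hn
  have hn1 : 1 ≤ n := Nat.ceil_pos.2 (by positivity)
  have hn0 : (0 : ℝ) < n := by exact_mod_cast hn1
  have hup : n * (v - u) ≤ 5 * (r - l) := by
    have := (Nat.ceil_lt_add_one (a := 4 * (r - l) / (v - u)) (by positivity)).le
    rw [← hn] at this
    calc n * (v - u) ≤ (4 * (r - l) / (v - u) + 1) * (v - u) :=
          mul_le_mul_of_nonneg_right this hε.le
      _ = 4 * (r - l) + (v - u) := by field_simp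
      _ ≤ _ := by linarith
  have hsmall : (r - l) / n ≤ (v - u) / 4 := by
    have := Nat.le_ceil (4 * (r - l) / (v - u))
    rw [← hn, div_le_iff₀ hε] at this
    rw [div_le_iff₀ hn0]
    linarith
  obtain ⟨a, ha, hau, hau'⟩ := hC' n hn1 (u + (v - u) / 2) ⟨by linarith, by linarith⟩
  obtain ⟨b, hb, hbu, hbu'⟩ := hC' n hn1 (u + 7 / 8 * (v - u)) ⟨by linarith, by linarith⟩
  have hab : a < b := by linarith
  have hsub : Ico a b ⊆ Ioo u v := fun x hx => ⟨by linarith [hx.1], by linarith [hx.2]⟩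
  have hCn1 : 1 ≤ C' * n := Nat.mul_pos hC1' hn1
  have hret := hC (C' * n) hCn1 a b ha hb hab
  have hbound : ∀ k : ℕ, k ≤ C * (C' * n) → k * (v - u) ≤ C * C' * (5 * (r - l)) := by
    intro k hk
    have hk' : (k : ℝ) ≤ C * (C' * n) := by exact_mod_cast hk
    calc k * (v - u) ≤ C * (C' * n) * (v - u) := mul_le_mul_of_nonneg_right hk' hε.le
      _ = C * C' * (n * (v - u)) := by ring
      _ ≤ _ := mul_le_mul_of_nonneg_left hup (by positivity)
  obtain ⟨k, hk, hkm⟩ := h.exists_inv_pow_mem_of_returnTime_le (by linarith) hab (by linarith)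
    hret hz
  obtain ⟨k', hk0', hk', hkm'⟩ := h.exists_pow_mem_of_returnTime_le (by linarith) hab
    (by linarith) hret hz
  exact ⟨⟨k, hbound k hk.le, hsub hkm⟩, k', hk0', hbound k' hk', hsub hkm'⟩

end RegularTranslation

section sepPt

variable {s : ℕ} {l : ℝ} {len : Fin s → ℝ}

theorem sepPt_add_len_le (hpos : ∀ i, 0 < len i) {i j : Fin s} (hij : i < j) :
    sepPt l len i + len i ≤ sepPt l len j := by
  have h1 : ∑ k ∈ insert i (Finset.univ.filter (fun k => k < i)), len k ≤
      ∑ k ∈ Finset.univ.filter (fun k => k < j), len k := by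
    refine Finset.sum_le_sum_of_subset_of_nonneg ?_ fun k _ _ => (hpos k).le
    intro k hk
    simp only [Finset.mem_insert, Finset.mem_filter, Finset.mem_univ, true_and] at hk ⊢
    rcases hk with rfl | hk
    · exact hij
    · exact hk.trans hij
  rw [Finset.sum_insert (by simp)] at h1
  unfold sepPt
  linarith

theorem sepPt_strictMono (hpos : ∀ i, 0 < len i) : StrictMono (sepPt l len) := fun i _ hij =>
  (lt_add_of_pos_right _ (hpos i)).trans_le (sepPt_add_len_le hpos hij)

theorem le_sepPt (hpos : ∀ i, 0 < len i) (i : Fin s) : l ≤ sepPt l len i :=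
  le_add_of_nonneg_right (Finset.sum_nonneg fun k _ => (hpos k).le)

theorem sepPt_add_len_le_add_sum (hpos : ∀ i, 0 < len i) (i : Fin s) :
    sepPt l len i + len i ≤ l + ∑ k, len k := by
  have h1 : ∑ k ∈ insert i (Finset.univ.filter (fun k => k < i)), len k ≤ ∑ k, len k :=
    Finset.sum_le_sum_of_subset_of_nonneg (Finset.subset_univ _) fun k _ _ => (hpos k).le
  rw [Finset.sum_insert (by simp)] at h1
  unfold sepPt
  linarith

theorem sepPt_of_val_eq_zero {i : Fin s} (hi : (i : ℕ) = 0) : sepPt l len i = l := by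
  unfold sepPt
  rw [Finset.filter_false_of_mem, Finset.sum_empty, add_zero]
  intro j _ hj
  rw [Fin.lt_def] at hj
  omega

theorem sepPt_of_val_eq_succ {i j : Fin s} (hj : (j : ℕ) = i + 1) :
    sepPt l len j = sepPt l len i + len i := by
  unfold sepPt
  have : Finset.univ.filter (fun k => k < j) = insert i (Finset.univ.filter (fun k => k < i)) := by
    ext k
    simp only [Finset.mem_filter, Finset.mem_univ, true_and, Finset.mem_insert, Fin.lt_def,
      Fin.ext_iff]
    omega
  rw [this, Finset.sum_insert (by simp)]
  ring

theorem sepPt_add_len_of_val_add_one_eq {i : Fin s} (hi : (i : ℕ) + 1 = s) :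
    sepPt l len i + len i = l + ∑ k, len k := by
  unfold sepPt
  have : (Finset.univ : Finset (Fin s)) = insert i (Finset.univ.filter (fun k => k < i)) := by
    ext k
    simp only [Finset.mem_filter, Finset.mem_univ, true_and, Finset.mem_insert, Fin.lt_def,
      Fin.ext_iff, true_iff]
    omega
  conv_rhs => rw [this, Finset.sum_insert (by simp)]
  ring

theorem exists_mem_Ico_sepPt {z : ℝ} (hz : z ∈ Ico l (l + ∑ k, len k)) :
    ∃ i, z ∈ Ico (sepPt l len i) (sepPt l len i + len i) := by
  rcases Nat.eq_zero_or_pos s with rfl | hs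
  · simp at hz
  obtain ⟨i, hi, hmax⟩ := Finset.exists_max_image (Finset.univ.filter fun i => sepPt l len i ≤ z)
    id ⟨⟨0, hs⟩, by simpa [sepPt_of_val_eq_zero] using hz.1⟩
  simp only [Finset.mem_filter, Finset.mem_univ, true_and, id] at hi hmax
  refine ⟨i, hi, ?_⟩
  by_cases hlast : (i : ℕ) + 1 = s
  · rw [sepPt_add_len_of_val_add_one_eq hlast]
    exact hz.2
  · by_contra! hle
    have := hmax ⟨i + 1, by omega⟩ (by rwa [sepPt_of_val_eq_succ (i := i) rfl])
    rw [Fin.le_def] at this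
    simp at this

theorem eq_of_mem_Ico_sepPt (hpos : ∀ i, 0 < len i) {i j : Fin s} {z : ℝ}
    (hi : z ∈ Ico (sepPt l len i) (sepPt l len i + len i))
    (hj : z ∈ Ico (sepPt l len j) (sepPt l len j + len j)) : i = j := by
  rcases lt_trichotomy i j with h | h | h
  · linarith [sepPt_add_len_le (l := l) hpos h, hi.2, hj.1]
  · exact h
  · linarith [sepPt_add_len_le (l := l) hpos h, hj.2, hi.1]

end sepPt

/-- The nonzero separation points. -/
def sepFinset {s : ℕ} (l : ℝ) (len : Fin s → ℝ) : Finset ℝ :=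
  (Finset.univ.filter fun i : Fin s => (i : ℕ) ≠ 0).image (sepPt l len)

theorem mem_sepFinset {s : ℕ} {l : ℝ} {len : Fin s → ℝ} {x : ℝ} :
    x ∈ sepFinset l len ↔ ∃ i : Fin s, (i : ℕ) ≠ 0 ∧ sepPt l len i = x := by
  simp [sepFinset]

theorem card_sepFinset {s : ℕ} {l : ℝ} {len : Fin s → ℝ} (hs : 0 < s) (hpos : ∀ i, 0 < len i) :
    (sepFinset l len).card + 1 = s := by
  rw [sepFinset, Finset.card_image_of_injective _ (sepPt_strictMono hpos).injective]
  have : (Finset.univ.filter fun i : Fin s => (i : ℕ) ≠ 0) = Finset.univ.erase ⟨0, hs⟩ := by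
    ext i
    simp [Fin.ext_iff]
  rw [this, Finset.card_erase_of_mem (Finset.mem_univ _), Finset.card_univ, Fintype.card_fin]
  omega

namespace IsIET

variable {s : ℕ} {l r : ℝ} {len : Fin s → ℝ} {π : Equiv.Perm (Fin s)} {T : Equiv.Perm ℝ}

theorem exists_mem_Ico (h : IsIET s l r len π T) {z : ℝ} (hz : z ∈ Ico l r) :
    ∃ i, z ∈ Ico (sepPt l len i) (sepPt l len i + len i) := by
  refine exists_mem_Ico_sepPt ?_
  rw [h.2.2.1]
  simpa using hz

theorem apply_eq (h : IsIET s l r len π T) {i : Fin s} {z : ℝ}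
    (hz : z ∈ Ico (sepPt l len i) (sepPt l len i + len i)) :
    T z = z + (imgPt l len π i - sepPt l len i) := h.2.2.2.2 i z hz

theorem apply_sepPt (h : IsIET s l r len π T) (i : Fin s) :
    T (sepPt l len i) = imgPt l len π i := by
  rw [h.apply_eq ⟨le_rfl, lt_add_of_pos_right _ (h.2.1 i)⟩]
  ring

theorem measurableSet_image_and_volume_image (h : IsIET s l r len π T) {B : Set ℝ}
    (hB : B ⊆ Ico l r) (hm : MeasurableSet B) :
    MeasurableSet (T '' B) ∧ volume (T '' B) = volume B := by
  set I : Fin s → Set ℝ := fun i => B ∩ Ico (sepPt l len i) (sepPt l len i + len i)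
  have hI : B = ⋃ i, I i := by
    rw [← inter_iUnion, eq_comm, inter_eq_left]
    intro z hz
    exact mem_iUnion.2 (h.exists_mem_Ico (hB hz))
  have hImeas : ∀ i, MeasurableSet (I i) := fun i => hm.inter measurableSet_Ico
  have himg : ∀ i, T '' I i =
      (fun x => x + -(imgPt l len π i - sepPt l len i)) ⁻¹' I i := by
    intro i
    rw [← image_add_right]
    exact image_congr fun z hz => h.apply_eq hz.2
  have hdisj : Pairwise (Function.onFun Disjoint I) := by
    intro i j hij
    refine disjoint_left.2 fun z hz hz' => hij (eq_of_mem_Ico_sepPt h.2.1 hz.2 hz'.2)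
  have hmeas : ∀ i, MeasurableSet (T '' I i) := by
    intro i
    rw [himg]
    exact (measurable_add_const _) (hImeas i)
  have himgU : T '' B = ⋃ i, T '' I i := by
    conv_lhs => rw [hI, image_iUnion]
  refine ⟨by rw [himgU]; exact MeasurableSet.iUnion hmeas, ?_⟩
  rw [himgU, measure_iUnion (fun i j hij => (disjoint_image_iff T.injective).2 (hdisj hij)) hmeas]
  conv_rhs => rw [hI, measure_iUnion hdisj hImeas]
  refine tsum_congr fun i => ?_
  rw [himg, measure_preimage_add_right]

theorem piecewiseTranslation (h : IsIET s l r len π T) :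
    PiecewiseTranslation T l r (sepFinset l len) where
  fix := h.2.2.2.1
  trans y y' hy hyy' hy' hc := by
    obtain ⟨i, hi⟩ := h.exists_mem_Ico ⟨hy.trans hyy', hy'⟩
    have hiy : sepPt l len i ≤ y := by
      by_contra! hlt
      refine hc _ ⟨hlt, hi.1⟩ (mem_sepFinset.2 ⟨i, fun h0 => ?_, rfl⟩)
      rw [sepPt_of_val_eq_zero h0] at hlt
      linarith
    rw [h.apply_eq hi, h.apply_eq (i := i) ⟨hiy, hyy'.trans_lt hi.2⟩]
    ring
  wander p q n hp hpq hq hw := by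
    have hmem : ∀ z, T z ∈ Ico l r ↔ z ∈ Ico l r := by
      have hinto : ∀ z ∈ Ico l r, T z ∈ Ico l r := by
        intro z hz
        by_contra hn
        have := h.2.2.2.1 _ hn
        rw [T.injective this] at hn
        exact hn hz
      refine fun z => ⟨fun hz => ?_, hinto z⟩
      by_contra hn
      rw [h.2.2.2.1 z hn] at hz
      exact hn hz
    have hsub : Ico p q ⊆ Ico l r := Ico_subset_Ico hp hq
    have hk : ∀ k : ℕ, (T ^ k) '' Ico p q ⊆ Ico l r ∧ MeasurableSet ((T ^ k) '' Ico p q) ∧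
        volume ((T ^ k) '' Ico p q) = ENNReal.ofReal (q - p) := by
      intro k
      induction k with
      | zero => simpa using hsub
      | succ k ih =>
        obtain ⟨h1, h2, h3⟩ := ih
        have he : (T ^ (k + 1)) '' Ico p q = T '' ((T ^ k) '' Ico p q) := by
          rw [pow_succ', image_image]
          rfl
        obtain ⟨h4, h5⟩ := h.measurableSet_image_and_volume_image h1 h2
        rw [he]
        refine ⟨?_, h4, h5.trans h3⟩
        rintro _ ⟨z, hz, rfl⟩
        exact (hmem z).2 (h1 hz)
    have hdisj : (↑(Finset.range n) : Set ℕ).PairwiseDisjoint fun k => (T ^ k) '' Ico p q := by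
      have key : ∀ j k, j < k → k < n → Disjoint ((T ^ j) '' Ico p q) ((T ^ k) '' Ico p q) := by
        intro j k hjk hkn
        refine disjoint_left.2 ?_
        rintro _ ⟨z, hz, rfl⟩ ⟨w, hw', he⟩
        have := pow_apply_eq_pow_sub hjk.le he.symm
        exact hw (k - j) (by omega) (by omega) w hw' (this ▸ hz)
      intro j hj k hk hjk
      simp only [Finset.coe_range, mem_Iio] at hj hk
      rcases lt_or_gt_of_ne hjk with hlt | hlt
      · exact key j k hlt hk
      · exact (key k j hlt hj).symm
    have h1 : volume (⋃ k ∈ Finset.range n, (T ^ k) '' Ico p q) ≤ volume (Ico l r) :=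
      measure_mono (iUnion₂_subset fun k _ => (hk k).1)
    rw [measure_biUnion_finset hdisj fun k _ => (hk k).2.1,
      Finset.sum_congr rfl fun k _ => (hk k).2.2, Real.volume_Ico, Finset.sum_const,
      Finset.card_range, ← ENNReal.ofReal_nsmul, nsmul_eq_mul,
      ENNReal.ofReal_le_ofReal_iff (sub_pos.2 h.1).le] at h1
    exact h1

end IsIET

theorem IsRegularIET.zpow_apply_eq {s : ℕ} {l : ℝ} {len : Fin s → ℝ} {T : Equiv.Perm ℝ}
    (h : IsRegularIET s l len T) {i j : Fin s} (hi : (i : ℕ) ≠ 0) (hj : (j : ℕ) ≠ 0) {n : ℤ}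
    (hn : (T ^ n) (sepPt l len i) = sepPt l len j) : i = j ∧ n = 0 := by
  have hij : i = j := by
    by_contra hne
    exact disjoint_left.1 (h.2 i j hi hj hne) ⟨n, hn⟩ ⟨0, rfl⟩
  subst hij
  refine ⟨rfl, ?_⟩
  by_contra hn0
  refine h.1 i hi (((finite_Ico 0 |n|).image fun k : ℤ => (T ^ k) (sepPt l len i)).subset ?_)
  rintro _ ⟨k, rfl⟩
  refine ⟨k % n, ⟨Int.emod_nonneg _ hn0, Int.emod_lt_abs _ hn0⟩, ?_⟩
  have hfix : ∀ q : ℤ, (T ^ (n * q)) (sepPt l len i) = sepPt l len i := by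
    intro q
    rw [zpow_mul]
    exact Equiv.Perm.zpow_apply_eq_self_of_apply_eq_self hn q
  conv_rhs => rw [← Int.emod_add_mul_ediv k n, zpow_add, Equiv.Perm.mul_apply, hfix]

theorem IsIET.regularTranslation {s : ℕ} {l r : ℝ} {len : Fin s → ℝ} {π : Equiv.Perm (Fin s)}
    {T : Equiv.Perm ℝ} (h : IsIET s l r len π T) (hs : 2 ≤ s) (hreg : IsRegularIET s l len T) :
    RegularTranslation T l r (sepFinset l len) where
  toPiecewiseTranslation := h.piecewiseTranslation
  lt := h.1
  sub x hx := by
    obtain ⟨i, hi, rfl⟩ := mem_sepFinset.1 hx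
    have h0 : (⟨0, by omega⟩ : Fin s) < i := by
      rw [Fin.lt_def]
      exact Nat.pos_of_ne_zero hi
    have h1 := sepPt_strictMono (l := l) h.2.1 h0
    rw [sepPt_of_val_eq_zero rfl] at h1
    have h2 := sepPt_add_len_le_add_sum (l := l) h.2.1 i
    rw [h.2.2.1] at h2
    exact ⟨h1, by linarith [h.2.1 i]⟩
  reg x hx y hy n hn := by
    obtain ⟨i, hi, rfl⟩ := mem_sepFinset.1 hx
    obtain ⟨j, hj, rfl⟩ := mem_sepFinset.1 hy
    exact (hreg.zpow_apply_eq hi hj hn).2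
  start := by
    set m := π.symm ⟨0, by omega⟩ with hm
    have himg : imgPt l len π m = l := by
      unfold imgPt
      rw [Finset.filter_false_of_mem, Finset.sum_empty, add_zero]
      intro j _ hj
      rw [hm, Equiv.apply_symm_apply, Fin.lt_def] at hj
      simp at hj
    refine ⟨sepPt l len m, mem_sepFinset.2 ⟨m, fun hm0 => ?_, rfl⟩, by rw [h.apply_sepPt, himg]⟩
    have hm0' : m = ⟨0, by omega⟩ := Fin.ext hm0
    have hπ0 : π ⟨0, by omega⟩ = ⟨0, by omega⟩ := by
      have := π.apply_symm_apply ⟨0, by omega⟩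
      rwa [← hm, hm0'] at this
    set j := π.symm ⟨1, by omega⟩ with hj
    have hπj : π j = ⟨1, by omega⟩ := by rw [hj, Equiv.apply_symm_apply]
    have hj0 : (j : ℕ) ≠ 0 := by
      intro hj0
      have : j = ⟨0, by omega⟩ := Fin.ext hj0
      rw [this, hπ0] at hπj
      simp at hπj
    have himgj : imgPt l len π j = sepPt l len ⟨1, by omega⟩ := by
      unfold imgPt sepPt
      congr 2
      ext k
      simp only [Finset.mem_filter, Finset.mem_univ, true_and, hπj, Fin.lt_def, Nat.lt_one_iff]
      constructor
      · intro hk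
        have : π k = π ⟨0, by omega⟩ := by rw [hπ0]; exact Fin.ext hk
        rw [π.injective this]
      · intro hk
        have : k = ⟨0, by omega⟩ := Fin.ext hk
        rw [this, hπ0]
    have := hreg.zpow_apply_eq (n := 1) hj0 (j := ⟨1, by omega⟩) (by simp)
      (by rw [zpow_one, h.apply_sepPt, himgj])
    exact one_ne_zero this.2

/-- `x` lies in `N⁻¹ ℤ[√d]`, and the conjugate of `N x` is bounded by `B`. -/
def ConjBound (d : ℤ) (N : ℕ) (B x : ℝ) : Prop :=
  ∃ m n : ℤ, N * x = m + n * √(d : ℝ) ∧ |(m : ℝ) - n * √(d : ℝ)| ≤ B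

namespace ConjBound

variable {d : ℤ} {N : ℕ} {B B' x y : ℝ}

theorem mono (h : ConjBound d N B x) (hB : B ≤ B') : ConjBound d N B' x := by
  obtain ⟨m, n, h1, h2⟩ := h
  exact ⟨m, n, h1, h2.trans hB⟩

theorem zero : ConjBound d N 0 0 := ⟨0, 0, by simp, by simp⟩

theorem add (h : ConjBound d N B x) (h' : ConjBound d N B' y) :
    ConjBound d N (B + B') (x + y) := by
  obtain ⟨m, n, h1, h2⟩ := h
  obtain ⟨m', n', h1', h2'⟩ := h'
  refine ⟨m + m', n + n', by push_cast; linear_combination h1 + h1', ?_⟩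
  push_cast
  refine le_trans (le_of_eq ?_) ((abs_add_le _ _).trans (add_le_add h2 h2'))
  congr 1
  ring

theorem neg (h : ConjBound d N B x) : ConjBound d N B (-x) := by
  obtain ⟨m, n, h1, h2⟩ := h
  refine ⟨-m, -n, by push_cast; linear_combination -h1, ?_⟩
  rw [← abs_neg]
  push_cast
  convert h2 using 2
  ring

theorem sub (h : ConjBound d N B x) (h' : ConjBound d N B' y) :
    ConjBound d N (B + B') (x - y) := by
  rw [sub_eq_add_neg]
  exact h.add h'.neg

theorem sum {ι : Type*} {f : ι → ℝ} (h : ∀ i, ConjBound d N B (f i)) (t : Finset ι) :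
    ConjBound d N (t.card * B) (∑ i ∈ t, f i) := by
  classical
  induction t using Finset.induction_on with
  | empty => simpa using zero
  | insert a t ha ih =>
    rw [Finset.sum_insert ha, Finset.card_insert_of_notMem ha]
    refine ((h a).add ih).mono (le_of_eq ?_)
    push_cast
    ring

theorem one_le_mul (hd : ∀ k : ℤ, d ≠ k * k) (hd0 : 0 ≤ d) (hN : 0 < N)
    (h : ConjBound d N B x) (hx : x ≠ 0) : 1 ≤ N * |x| * B := by
  obtain ⟨m, n, h1, h2⟩ := h
  have hN0 : (N : ℝ) ≠ 0 := by positivity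
  have hsq : √(d : ℝ) * √(d : ℝ) = d := Real.mul_self_sqrt (by exact_mod_cast hd0)
  have hne : (⟨m, n⟩ : ℤ√d).norm ≠ 0 := by
    rw [Ne, Zsqrtd.norm_eq_zero hd]
    intro h0
    rw [Zsqrtd.ext_iff] at h0
    simp only [Zsqrtd.re_zero, Zsqrtd.im_zero] at h0
    rw [h0.1, h0.2] at h1
    simp [hN0, hx] at h1
  have hone : (1 : ℝ) ≤ |((⟨m, n⟩ : ℤ√d).norm : ℝ)| := by
    exact_mod_cast Int.one_le_abs hne
  have hnorm : (((⟨m, n⟩ : ℤ√d).norm : ℤ) : ℝ) = (N * x) * (m - n * √(d : ℝ)) := by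
    rw [h1, Zsqrtd.norm_def]
    push_cast
    linear_combination ((n : ℝ) * n) * hsq
  rw [hnorm, abs_mul, abs_mul, Nat.abs_cast] at hone
  exact hone.trans (mul_le_mul_of_nonneg_left h2 (by positivity))

theorem mul_unit (hd0 : 0 ≤ d) {a b : ℤ} (h : ConjBound d N B x) :
    ConjBound d N (|(a : ℝ) - b * √(d : ℝ)| * B) ((a + b * √(d : ℝ)) * x) := by
  obtain ⟨m, n, h1, h2⟩ := h
  have hsq : √(d : ℝ) * √(d : ℝ) = d := Real.mul_self_sqrt (by exact_mod_cast hd0)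
  refine ⟨a * m + b * n * d, a * n + b * m, ?_, ?_⟩
  · push_cast
    linear_combination (a + b * √(d : ℝ)) * h1 + b * n * hsq
  · refine le_trans (le_of_eq ?_) (mul_le_mul_of_nonneg_left h2 (abs_nonneg _))
    rw [← abs_mul]
    congr 1
    push_cast
    linear_combination (-b * n : ℝ) * hsq

theorem finite_setOf_abs_le (hd : 1 ≤ d) (hN : 0 < N) (K B : ℝ) :
    {x | |x| ≤ K ∧ ConjBound d N B x}.Finite := by
  have hN0 : (N : ℝ) ≠ 0 := by positivity
  have hs1 : 1 ≤ √(d : ℝ) := by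
    rw [Real.one_le_sqrt]
    exact_mod_cast hd
  set M : ℤ := ⌈N * K + B⌉
  refine (((finite_Icc (-M) M).prod (finite_Icc (-M) M)).image
    fun p : ℤ × ℤ => (p.1 + p.2 * √(d : ℝ)) / N).subset ?_
  rintro x ⟨hx, m, n, h1, h2⟩
  have hM : N * K + B ≤ M := Int.le_ceil _
  have hNx : |(m : ℝ) + n * √(d : ℝ)| ≤ N * K := by
    rw [← h1, abs_mul, Nat.abs_cast]
    exact mul_le_mul_of_nonneg_left hx (by positivity)
  have hm : |(m : ℝ)| ≤ M := by
    rw [abs_le] at *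
    constructor <;> linarith
  have hn : |(n : ℝ)| ≤ M := by
    have h3 : |(n : ℝ) * √(d : ℝ)| ≤ M := by
      rw [abs_le] at *
      constructor <;> linarith
    rw [abs_mul, abs_of_nonneg (Real.sqrt_nonneg _)] at h3
    exact (le_mul_of_one_le_right (abs_nonneg _) hs1).trans h3
  refine ⟨(m, n), ⟨?_, ?_⟩, ?_⟩
  · exact abs_le.1 (by exact_mod_cast hm)
  · exact abs_le.1 (by exact_mod_cast hn)
  · change (m + n * √(d : ℝ)) / N = x
    rw [← h1, mul_div_cancel_left₀ _ hN0]

end ConjBound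

/-- Multiplication by a suitable unit `η > 1` of `ℤ[√d]` divides the size of conjugates by `η`. -/
theorem exists_unit_conjBound {d : ℤ} (hd : 1 ≤ d) (hsq : ∀ k : ℤ, d ≠ k * k) :
    ∃ η : ℝ, 1 < η ∧ ∀ (N : ℕ) (B x : ℝ) (k : ℤ), ConjBound d N B x →
      ConjBound d N ((η ^ k)⁻¹ * B) (η ^ k * x) := by
  obtain ⟨a, b, hab, hb⟩ := Pell.exists_of_not_isSquare (by omega : 0 < d)
    (by rintro ⟨k, hk⟩; exact hsq k hk)
  have hb1 : (1 : ℝ) ≤ |(b : ℝ)| := by exact_mod_cast Int.one_le_abs hb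
  have hd1 : (1 : ℝ) ≤ d := by exact_mod_cast hd
  have hs1 : 1 ≤ √(d : ℝ) := by rwa [Real.one_le_sqrt]
  have hss : √(d : ℝ) * √(d : ℝ) = d := Real.mul_self_sqrt (by linarith)
  have hab' : (|(a : ℝ)|) ^ 2 - d * |(b : ℝ)| ^ 2 = 1 := by
    rw [sq_abs, sq_abs]
    exact_mod_cast hab
  have ha1 : 1 ≤ |(a : ℝ)| := by nlinarith [abs_nonneg (a : ℝ), abs_nonneg (b : ℝ)]
  have hmul : (|(a : ℝ)| + |(b : ℝ)| * √(d : ℝ)) * (|(a : ℝ)| - |(b : ℝ)| * √(d : ℝ)) = 1 := by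
    linear_combination hab' - |(b : ℝ)| ^ 2 * hss
  set η : ℝ := |(a : ℝ)| + |(b : ℝ)| * √(d : ℝ) with hη
  have hη1 : 1 < η := by nlinarith
  have hη0 : 0 < η := by linarith
  have hinv : |(a : ℝ)| - |(b : ℝ)| * √(d : ℝ) = η⁻¹ := eq_inv_of_mul_eq_one_right hmul
  refine ⟨η, hη1, fun N B x k h => ?_⟩
  have hup : ∀ B x, ConjBound d N B x → ConjBound d N (η⁻¹ * B) (η * x) := by
    intro B x h
    have := h.mul_unit (by omega) (a := |a|) (b := |b|)
    push_cast at this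
    rwa [hinv, abs_of_pos (inv_pos.2 hη0)] at this
  have hdown : ∀ B x, ConjBound d N B x → ConjBound d N (η * B) (η⁻¹ * x) := by
    intro B x h
    have := h.mul_unit (by omega) (a := |a|) (b := -|b|)
    push_cast at this
    rwa [neg_mul, sub_neg_eq_add, ← sub_eq_add_neg, hinv, ← hη, abs_of_pos hη0] at this
  induction k with
  | zero => simpa using h
  | succ k ih =>
    have := hup _ _ ih
    rw [← mul_assoc, ← mul_assoc] at this
    rwa [zpow_add_one₀ hη0.ne', mul_inv, mul_comm (η ^ (k : ℤ))⁻¹, mul_comm (η ^ (k : ℤ))]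
  | pred k ih =>
    have := hdown _ _ ih
    rw [← mul_assoc, ← mul_assoc] at this
    rwa [zpow_sub_one₀ hη0.ne', mul_inv, inv_inv, mul_comm (η ^ (-(k : ℤ)))⁻¹,
      mul_comm (η ^ (-(k : ℤ)))]

theorem exists_conjBound_of_rat {d : ℤ} {s : ℕ} {len : Fin s → ℝ}
    (hQ : ∀ i : Fin s, ∃ p q : ℚ, len i = (p : ℝ) + (q : ℝ) * √(d : ℝ)) :
    ∃ N : ℕ, 0 < N ∧ ∃ B, 0 < B ∧ ∀ i, ConjBound d N B (len i) := by
  choose p q hpq using hQ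
  set N := ∏ i, (p i).den * (q i).den with hN
  have hint : ∀ x : ℚ, x.den ∣ N → ∃ m : ℤ, (N : ℝ) * x = m := by
    rintro x ⟨k, hk⟩
    refine ⟨k * x.num, ?_⟩
    rw [hk]
    have : (x : ℝ) * x.den = x.num := by exact_mod_cast x.mul_den_eq_num
    push_cast
    linear_combination (k : ℝ) * this
  have hdvd : ∀ i, (p i).den * (q i).den ∣ N := fun i =>
    Finset.dvd_prod_of_mem (fun i => (p i).den * (q i).den) (Finset.mem_univ i)
  choose m hm using fun i => hint (p i) ((Dvd.intro _ rfl).trans (hdvd i))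
  choose n hn using fun i => hint (q i) ((Dvd.intro_left _ rfl).trans (hdvd i))
  refine ⟨N, Finset.prod_pos fun i _ => Nat.mul_pos (p i).den_pos (q i).den_pos,
    1 + ∑ i, |(m i : ℝ) - n i * √(d : ℝ)|, by positivity, fun i => ⟨m i, n i, ?_, ?_⟩⟩
  · rw [hpq, mul_add, hm, ← mul_assoc, hn]
  · have := Finset.single_le_sum (f := fun i => |(m i : ℝ) - n i * √(d : ℝ)|)
      (fun i _ => abs_nonneg _) (Finset.mem_univ i)
    linarith

theorem IsIET.exists_conjBound {d : ℤ} {s : ℕ} {l r : ℝ} {len : Fin s → ℝ}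
    {π : Equiv.Perm (Fin s)} {T : Equiv.Perm ℝ} (h : IsIET s l r len π T)
    (hQ : ∀ i : Fin s, ∃ p q : ℚ, len i = (p : ℝ) + (q : ℝ) * √(d : ℝ)) :
    ∃ N : ℕ, 0 < N ∧ ∃ A, 0 < A ∧ ConjBound d N A (r - l) ∧
      ∀ n p, NearOrbit T (sepFinset l len) n p → ConjBound d N (A * (n + 1)) (p - l) := by
  obtain ⟨N, hN, B, hB, hlen⟩ := exists_conjBound_of_rat hQ
  have hsum : ∀ t : Finset (Fin s), ConjBound d N (s * B) (∑ i ∈ t, len i) := fun t =>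
    (ConjBound.sum hlen t).mono (mul_le_mul_of_nonneg_right
      (by simpa using Finset.card_le_univ t) hB.le)
  have hsep : ∀ i, ConjBound d N (s * B) (sepPt l len i - l) := fun i => by
    unfold sepPt
    rw [add_sub_cancel_left]
    exact hsum _
  have himg : ∀ i, ConjBound d N (s * B) (imgPt l len π i - l) := fun i => by
    unfold imgPt
    rw [add_sub_cancel_left]
    exact hsum _
  set A := 2 * (s * B) + 1 with hA
  have hA0 : 0 ≤ s * B := by positivity
  have hstep : ∀ z ∈ Ico l r, ConjBound d N A (T z - z) := by
    intro z hz
    obtain ⟨i, hi⟩ := h.exists_mem_Ico hz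
    rw [h.apply_eq hi]
    have h1 := ((himg i).sub (hsep i)).mono (B' := A) (by linarith)
    rwa [sub_sub_sub_cancel_right, ← add_sub_cancel_left z (_ - _)] at h1
  have hpow : ∀ (k : ℕ), ∀ z ∈ Ico l r, ConjBound d N (A * k) ((T ^ k) z - z) := by
    intro k z hz
    induction k with
    | zero => simpa using ConjBound.zero
    | succ k ih =>
      have h1 := (hstep _ ((h.piecewiseTranslation.pow_mem_iff k z).2 hz)).add ih
      rw [sub_add_sub_cancel, ← Equiv.Perm.mul_apply, ← pow_succ'] at h1
      refine h1.mono (le_of_eq ?_)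
      push_cast
      ring
  refine ⟨N, hN, A, by linarith, ?_, ?_⟩
  · rw [← h.2.2.1]
    exact (hsum _).mono (by linarith)
  · rintro n _ ⟨x, hx, m, hm, rfl⟩
    obtain ⟨i, _, rfl⟩ := mem_sepFinset.1 hx
    have hmem : sepPt l len i ∈ Ico l r := ⟨le_sepPt h.2.1 i, by
      have := sepPt_add_len_le_add_sum (l := l) h.2.1 i
      rw [h.2.2.1] at this
      linarith [h.2.1 i]⟩
    have hzp : ConjBound d N (A * n) ((T ^ m) (sepPt l len i) - sepPt l len i) := by
      obtain ⟨k, rfl | rfl⟩ := m.eq_nat_or_neg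
      · rw [zpow_natCast]
        refine (hpow k _ hmem).mono (mul_le_mul_of_nonneg_left ?_ (by linarith))
        rw [Nat.abs_cast] at hm
        exact_mod_cast hm
      · have h1 := (hpow k _ ((h.piecewiseTranslation.zpow_mem_iff (-k) _).2 hmem)).neg
        rw [zpow_neg, zpow_natCast, perm_apply_inv_apply, neg_sub] at h1
        rw [zpow_neg, zpow_natCast]
        refine h1.mono (mul_le_mul_of_nonneg_left ?_ (by linarith))
        rw [abs_neg, Nat.abs_cast] at hm
        exact_mod_cast hm
    have h2 := hzp.add (hsep i)
    rw [sub_add_sub_cancel] at h2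
    refine h2.mono ?_
    linarith

theorem orbitGap_of_conjBound {d : ℤ} (hd : 0 ≤ d) (hsq : ∀ k : ℤ, d ≠ k * k) {T : Equiv.Perm ℝ}
    {D : Finset ℝ} {l A : ℝ} {N : ℕ} (hN : 0 < N) (hA : 0 < A)
    (h : ∀ n p, NearOrbit T D n p → ConjBound d N (A * (n + 1)) (p - l)) :
    OrbitGap T D (1 / (4 * A * N)) := by
  intro n hn p q hp hq hpq
  have h1 := (h n q hq).sub (h n p hp)
  rw [sub_sub_sub_cancel_right] at h1
  have hn1 : (1 : ℝ) ≤ n := by exact_mod_cast hn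
  have hN0 : (0 : ℝ) < N := by exact_mod_cast hN
  have h2 := (h1.mono (B' := 4 * A * n) (by nlinarith)).one_le_mul hsq hd hN (sub_pos.2 hpq).ne'
  rw [abs_of_pos (sub_pos.2 hpq)] at h2
  rw [div_le_iff₀ (by positivity)]
  linarith

/-- A bijection of `[u,v)` that is a translation on each of the semi-intervals `[γ_i, γ_i + λ_i)`
is an interval exchange transformation. -/
theorem exists_isIET_of_translation {s : ℕ} {u v : ℝ} (huv : u < v) {lam : Fin s → ℝ}
    (hpos : ∀ i, 0 < lam i) (hsum : ∑ i, lam i = v - u) {S : Equiv.Perm ℝ}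
    (hfix : ∀ z ∉ Ico u v, S z = z)
    (htrans : ∀ i, ∀ z ∈ Ico (sepPt u lam i) (sepPt u lam i + lam i),
      S z - z = S (sepPt u lam i) - sepPt u lam i) :
    ∃ σ : Equiv.Perm (Fin s), IsIET s u v lam σ S := by
  set f : Fin s → ℝ := fun i => S (sepPt u lam i) with hf
  have hfinj : Function.Injective f := S.injective.comp (sepPt_strictMono hpos).injective
  have hfS : ∀ i, ∀ t, 0 ≤ t → t < lam i → S (sepPt u lam i + t) = f i + t := by
    intro i t ht ht'
    have := htrans i (sepPt u lam i + t) ⟨by linarith, by linarith⟩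
    rw [hf]
    linarith
  have hmem : ∀ z, S z ∈ Ico u v ↔ z ∈ Ico u v := by
    have hinto : ∀ z ∈ Ico u v, S z ∈ Ico u v := by
      intro z hz
      by_contra hn
      rw [S.injective (hfix _ hn)] at hn
      exact hn hz
    refine fun z => ⟨fun hz => ?_, hinto z⟩
    by_contra hn
    rw [hfix z hn] at hz
    exact hn hz
  have hsep : ∀ i, sepPt u lam i ∈ Ico u v := fun i => ⟨le_sepPt hpos i, by
    have := sepPt_add_len_le_add_sum (l := u) hpos i
    linarith [hpos i]⟩
  have hgap : ∀ i j, f j < f i → f j + lam j ≤ f i := by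
    intro i j hji
    by_contra! hlt
    have h1 := hfS j (f i - f j) (by linarith) (by linarith)
    rw [add_sub_cancel] at h1
    have h2 := S.injective h1
    have h3 := eq_of_mem_Ico_sepPt (l := u) hpos (i := j) (j := i) (z := sepPt u lam i)
      ⟨by linarith, by linarith⟩ ⟨le_rfl, by linarith [hpos i]⟩
    rw [h3] at hji
    exact lt_irrefl _ hji
  set σ : Equiv.Perm (Fin s) := (Tuple.sort f).symm with hσ
  have hσlt : ∀ i j, σ j < σ i ↔ f j < f i := by
    have hmono : StrictMono (f ∘ Tuple.sort f) :=
      (Tuple.monotone_sort f).strictMono_of_injective (hfinj.comp (Tuple.sort f).injective)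
    intro i j
    rw [← hmono.lt_iff_lt]
    simp [hσ]
  have himg : ∀ i, imgPt u lam σ i = f i := by
    intro i
    have hU : Ico u (f i) = ⋃ j ∈ Finset.univ.filter (fun j => σ j < σ i),
        Ico (f j) (f j + lam j) := by
      ext z
      simp only [Finset.mem_filter, Finset.mem_univ, true_and, mem_iUnion, hσlt, exists_prop]
      constructor
      · intro hz
        have hzI : S (S⁻¹ z) ∈ Ico u v := by
          rw [perm_apply_inv_apply]
          exact ⟨hz.1, hz.2.trans ((hmem _).2 (hsep i)).2⟩
        obtain ⟨j, hj⟩ := exists_mem_Ico_sepPt (l := u) (len := lam) (z := S⁻¹ z) (by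
          rw [hsum, add_sub_cancel]
          exact (hmem _).1 hzI)
        have h1 := htrans j _ hj
        rw [perm_apply_inv_apply] at h1
        have h2 : z = f j + (S⁻¹ z - sepPt u lam j) := by rw [hf]; linarith
        have h3 : f j ≤ z := by linarith [hj.1]
        exact ⟨j, h3.trans_lt hz.2, h3, by linarith [hj.2]⟩
      · rintro ⟨j, hj, hz⟩
        exact ⟨((hmem _).2 (hsep j)).1.trans hz.1, hz.2.trans_le (hgap i j hj)⟩
    have hvol : volume (Ico u (f i)) =
        ∑ j ∈ Finset.univ.filter (fun j => σ j < σ i), ENNReal.ofReal (lam j) := by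
      rw [hU, measure_biUnion_finset _ fun _ _ => measurableSet_Ico]
      · refine Finset.sum_congr rfl fun j _ => ?_
        rw [Real.volume_Ico, add_sub_cancel_left]
      · intro j _ k _ hjk
        refine disjoint_left.2 fun z hz hz' => ?_
        rcases lt_or_gt_of_ne (hfinj.ne hjk) with hlt | hlt
        · linarith [hgap k j hlt, hz.2, hz'.1]
        · linarith [hgap j k hlt, hz.1, hz'.2]
    rw [Real.volume_Ico, ← ENNReal.ofReal_sum_of_nonneg fun j _ => (hpos j).le,
      ENNReal.ofReal_eq_ofReal_iff (sub_nonneg.2 ((hmem _).2 (hsep i)).1)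
        (Finset.sum_nonneg fun j _ => (hpos j).le)] at hvol
    unfold imgPt
    linarith
  refine ⟨σ, huv, hpos, hsum, hfix, fun i z hz => ?_⟩
  rw [himg, ← htrans i z hz]
  ring

/-- The points of `P` cut `[u,v)` into semi-intervals. -/
theorem exists_lengths {s : ℕ} {u v : ℝ} (huv : u < v) {P : Finset ℝ}
    (hP : ∀ x ∈ P, x ∈ Ioo u v) (hs : P.card + 1 = s) :
    ∃ lam : Fin s → ℝ, (∀ i, 0 < lam i) ∧ ∑ i, lam i = v - u ∧
      ∀ i, sepPt u lam i ∈ insert u P ∧ sepPt u lam i + lam i ∈ insert v P ∧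
        ∀ x ∈ Ioo (sepPt u lam i) (sepPt u lam i + lam i), x ∉ P := by
  have huP : u ∉ P := fun hu => lt_irrefl _ (hP u hu).1
  have hcard : (insert u P).card = s := by rw [Finset.card_insert_of_notMem huP, hs]
  set e := (insert u P).orderEmbOfFin hcard with he
  have hmem : ∀ i, e i ∈ insert u P := fun i => Finset.orderEmbOfFin_mem _ _ i
  have hsurj : ∀ x ∈ insert u P, ∃ i, e i = x := by
    intro x hx
    have : x ∈ Set.range e := by
      rw [he, Finset.range_orderEmbOfFin]
      exact hx
    exact this
  have hlt : ∀ i, e i < v := by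
    intro i
    rcases Finset.mem_insert.1 (hmem i) with h | h
    · rwa [h]
    · exact (hP _ h).2
  have hge : ∀ i, u ≤ e i := by
    intro i
    rcases Finset.mem_insert.1 (hmem i) with h | h
    · exact h.ge
    · exact (hP _ h).1.le
  set nxt : Fin s → ℝ := fun i => if h : (i : ℕ) + 1 < s then e ⟨i + 1, h⟩ else v with hnxt
  set lam : Fin s → ℝ := fun i => nxt i - e i with hlam
  have hpos : ∀ i, 0 < lam i := by
    intro i
    refine sub_pos.2 ?_
    simp only [hnxt]
    split_ifs with h
    · exact e.strictMono (by rw [Fin.lt_def]; exact Nat.lt_succ_self _)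
    · exact hlt i
  have hsep : ∀ (n : ℕ) (hn : n < s), sepPt u lam ⟨n, hn⟩ = e ⟨n, hn⟩ := by
    intro n
    induction n with
    | zero =>
      intro hn
      rw [sepPt_of_val_eq_zero rfl]
      obtain ⟨i, hi⟩ := hsurj u (Finset.mem_insert_self _ _)
      refine le_antisymm (hge _) ?_
      rw [← hi]
      exact e.monotone (by rw [Fin.le_def]; exact Nat.zero_le _)
    | succ n ih =>
      intro hn
      rw [sepPt_of_val_eq_succ (i := ⟨n, by omega⟩) rfl, ih (by omega)]
      simp [hlam, hnxt, hn]
  have hadd : ∀ i, sepPt u lam i + lam i = nxt i := by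
    intro i
    rw [hsep i i.2, hlam]
    ring
  refine ⟨lam, hpos, ?_, fun i => ⟨?_, ?_, ?_⟩⟩
  · have h1 := hadd ⟨s - 1, by omega⟩
    rw [sepPt_add_len_of_val_add_one_eq (by simp only []; omega)] at h1
    have h2 : nxt ⟨s - 1, by omega⟩ = v := by
      simp only [hnxt]
      rw [dif_neg (by omega)]
    linarith
  · rw [hsep i i.2]
    exact hmem i
  · rw [hadd, hnxt]
    simp only
    split_ifs with h
    · rcases Finset.mem_insert.1 (hmem ⟨i + 1, h⟩) with h1 | h1
      · have := e.strictMono (show i < ⟨i + 1, h⟩ by rw [Fin.lt_def]; exact Nat.lt_succ_self _)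
        linarith [hge i]
      · exact Finset.mem_insert_of_mem h1
    · exact Finset.mem_insert_self _ _
  · intro x hx hxP
    rw [hadd, hsep i i.2] at hx
    obtain ⟨j, rfl⟩ := hsurj x (Finset.mem_insert_of_mem hxP)
    have hij : i < j := e.lt_iff_lt.1 hx.1
    rw [Fin.lt_def] at hij
    have h2 := hx.2
    simp only [hnxt] at h2
    rw [dif_pos (by omega)] at h2
    have := e.lt_iff_lt.1 h2
    rw [Fin.lt_def] at this
    simp only at this
    omega

namespace PiecewiseTranslation

variable {T : Equiv.Perm ℝ} {l r u v : ℝ} {D : Finset ℝ}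

theorem exists_perm_eq_inducedMap (h : PiecewiseTranslation T l r D) (hu : l ≤ u) (hv : v ≤ r) :
    ∃ S : Equiv.Perm ℝ, (∀ z ∉ Ico u v, S z = z) ∧
      ∀ z ∈ Ico u v, S z = inducedMap T (Ico u v) z := by
  classical
  set f : ℝ → ℝ := fun z => if z ∈ Ico u v then inducedMap T (Ico u v) z else z
  have hf1 : ∀ z ∈ Ico u v, f z = inducedMap T (Ico u v) z := fun z hz => if_pos hz
  have hf2 : ∀ z ∉ Ico u v, f z = z := fun z hz => if_neg hz
  have hspec := fun z (hz : z ∈ Ico u v) => returnTime_spec (h.exists_return hu hv hz)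
  have hfmem : ∀ z ∈ Ico u v, f z ∈ Ico u v := fun z hz => by
    rw [hf1 z hz]
    exact (hspec z hz).2
  have hinj : Function.Injective f := by
    have key : ∀ z ∈ Ico u v, ∀ w ∈ Ico u v, f z = f w →
        returnTime T (Ico u v) z ≤ returnTime T (Ico u v) w → z = w := by
      intro z hz w hw hzw hle
      rw [hf1 z hz, hf1 w hw] at hzw
      have h1 := pow_apply_eq_pow_sub hle hzw
      rcases Nat.eq_zero_or_pos (returnTime T (Ico u v) w - returnTime T (Ico u v) z) with h0 | h0
      · simpa [h0] using h1
      · exact absurd (h1 ▸ hz) (notMem_of_lt_returnTime h0 (by have := (hspec z hz).1; omega))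
    intro z w hzw
    by_cases hz : z ∈ Ico u v <;> by_cases hw : w ∈ Ico u v
    · rcases le_total (returnTime T (Ico u v) z) (returnTime T (Ico u v) w) with hle | hle
      · exact key z hz w hw hzw hle
      · exact (key w hw z hz hzw.symm hle).symm
    · exact absurd (hf2 w hw ▸ hzw ▸ hfmem z hz) hw
    · exact absurd (hf2 z hz ▸ hzw ▸ hfmem w hw) hz
    · rwa [hf2 z hz, hf2 w hw] at hzw
  have hsurj : Function.Surjective f := by
    intro y
    by_cases hy : y ∈ Ico u v
    · have hex := h.inv.exists_return hu hv hy
      obtain ⟨hn0, hn⟩ := returnTime_spec hex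
      set n := returnTime T⁻¹ (Ico u v) y with hndef
      refine ⟨(T⁻¹ ^ n) y, ?_⟩
      have hback : ∀ i ≤ n, (T ^ i) ((T⁻¹ ^ n) y) = (T⁻¹ ^ (n - i)) y := by
        intro i hi
        conv_lhs => rw [← Nat.add_sub_cancel' hi, pow_add, Equiv.Perm.mul_apply, inv_pow,
          perm_apply_inv_apply]
      rw [hf1 _ hn, inducedMap, returnTime_eq_of_first hn0, hback n le_rfl]
      · simp
      · rw [hback n le_rfl]
        simpa using hy
      · intro i hi hin
        rw [hback i hin.le]
        exact notMem_of_lt_returnTime (by omega) (by omega)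
    · exact ⟨y, hf2 y hy⟩
  exact ⟨Equiv.ofBijective f ⟨hinj, hsurj⟩, hf2, hf1⟩

theorem exists_inducedData (h : PiecewiseTranslation T l r D) (hu : l ≤ u) (huv : u < v)
    (hv : v ≤ r) {s : ℕ} {P : Finset ℝ} (hP : ∀ x ∈ P, x ∈ Ioo u v)
    (hcuts : allCuts T D u v ⊆ P) (hs : P.card + 1 = s) :
    ∃ (lam : Fin s → ℝ) (σ : Equiv.Perm (Fin s)), InducedData T u v s lam σ ∧
      ∀ i, 0 < lam i ∧ lam i ≤ v - u ∧ ∃ p ∈ insert u P, ∃ q ∈ insert v P, lam i = q - p := by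
  obtain ⟨S, hfix, hS⟩ := h.exists_perm_eq_inducedMap hu hv
  obtain ⟨lam, hpos, hsum, hlam⟩ := exists_lengths huv hP hs
  have hend : ∀ i, sepPt u lam i + lam i ≤ v := fun i => by
    have := sepPt_add_len_le_add_sum (l := u) hpos i
    linarith
  obtain ⟨σ, hσ⟩ := exists_isIET_of_translation huv hpos hsum hfix (by
    intro i z hz
    have hi : sepPt u lam i ∈ Ico u v := ⟨le_sepPt hpos i, by linarith [hpos i, hend i]⟩
    have hz' : z ∈ Ico u v := ⟨hi.1.trans hz.1, hz.2.trans_le (hend i)⟩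
    rw [hS z hz', hS _ hi]
    exact (h.returnTime_const hu hv hi.1 hz.1 hz'.2 fun x hx hx' =>
      (hlam i).2.2 x ⟨hx.1, hx.2.trans_lt hz.2⟩ (hcuts hx')).2)
  refine ⟨lam, σ, ⟨S, hσ, hS⟩, fun i => ⟨hpos i, ?_, _, (hlam i).1, _, (hlam i).2.1, by ring⟩⟩
  linarith [hend i, le_sepPt (l := u) hpos i]

end PiecewiseTranslation

theorem rhoMinusPt_eq_of_first {T : Equiv.Perm ℝ} {u v x y : ℝ} {j : ℕ} (hx : x ∈ Ioo u v)
    (hj : (T ^ j) x = y) (hfirst : ∀ i, 0 < i → i ≤ j → (T ^ i) x ∉ Ioo u v) :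
    rhoMinusPt T u v y = j ∧ (T⁻¹ ^ rhoMinusPt T u v y) y = x := by
  have hback : ∀ i ≤ j, (T⁻¹ ^ i) y = (T ^ (j - i)) x := by
    intro i hi
    conv_lhs => rw [← hj, ← Nat.add_sub_cancel' hi, pow_add, Equiv.Perm.mul_apply, inv_pow,
      perm_inv_apply_apply]
  have hjx : (T⁻¹ ^ j) y = x := by rw [hback j le_rfl]; simp
  have hrho : rhoMinusPt T u v y = j := by
    refine le_antisymm (Nat.sInf_le (by rwa [mem_ofPred_eq, hjx])) (le_csInf ⟨j, by
      rwa [mem_ofPred_eq, hjx]⟩ fun i hi => ?_)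
    by_contra! hlt
    rw [mem_ofPred_eq, hback i hlt.le] at hi
    exact hfirst _ (by omega) (by omega) hi
  exact ⟨hrho, hrho ▸ hjx⟩

theorem rhoMinusPt_spec {T : Equiv.Perm ℝ} {u v z : ℝ} (h : ∃ n : ℕ, (T⁻¹ ^ n) z ∈ Ioo u v) :
    (T⁻¹ ^ rhoMinusPt T u v z) z ∈ Ioo u v := Nat.sInf_mem h

/-- The neighbours of `z` outside `(u,v)` enter `(u,v)` backwards at the same point as `z`. -/
theorem inv_pow_rhoMinusPt_eq_of_mem_neighbours {T : Equiv.Perm ℝ} {u v z e : ℝ}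
    (h : ∃ n : ℕ, (T⁻¹ ^ n) z ∈ Ioo u v) (he : e ∈ neighbours T u v z) :
    (T⁻¹ ^ rhoMinusPt T u v e) e = (T⁻¹ ^ rhoMinusPt T u v z) z := by
  obtain ⟨k, hk1, hk2, rfl⟩ := he
  set m := rhoMinusPt T u v z with hm
  have hzw : ∀ i : ℕ, (T ^ i) ((T⁻¹ ^ m) z) = (T ^ ((i : ℤ) - m)) z := by
    intro i
    rw [← zpow_natCast, inv_pow, ← zpow_natCast, ← zpow_neg, ← Equiv.Perm.mul_apply, ← zpow_add,
      sub_eq_add_neg]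
  refine (rhoMinusPt_eq_of_first (j := (k + m).toNat) (rhoMinusPt_spec h) ?_ ?_).2
  · rw [hzw]
    congr 2
    omega
  · intro i hi0 hi
    rw [hzw]
    intro hmem
    rcases le_or_gt i m with him | him
    · have : (T⁻¹ ^ (m - i)) z ∈ Ioo u v := by
        rwa [show ((i : ℤ) - m) = -((m - i : ℕ) : ℤ) by omega, zpow_neg, zpow_natCast,
          ← inv_pow] at hmem
      have := Nat.sInf_le (s := {n : ℕ | (T⁻¹ ^ n) z ∈ Ioo u v}) this
      rw [rhoMinusPt] at hm
      omega
    · have : 0 < i - m ∧ (T ^ (i - m)) z ∈ Ioo u v := by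
        rw [show ((i : ℤ) - m) = ((i - m : ℕ) : ℤ) by omega, zpow_natCast] at hmem
        exact ⟨by omega, hmem⟩
      have := Nat.sInf_le (s := {n : ℕ | 0 < n ∧ (T ^ n) z ∈ Ioo u v}) this
      rw [rhoPlusPt] at hk2
      omega

/-- The first backward entries into `(u,v)` of the points of `D`. -/
def entryPoints (T : Equiv.Perm ℝ) (D : Finset ℝ) (u v : ℝ) : Finset ℝ :=
  D.image fun x => (T⁻¹ ^ rhoMinusPt T u v x) x

namespace RegularTranslation

variable {T : Equiv.Perm ℝ} {l r u v C : ℝ} {D : Finset ℝ}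

theorem card_entryPoints (h : RegularTranslation T l r D) (u v : ℝ) :
    (entryPoints T D u v).card = D.card := by
  refine Finset.card_image_of_injOn ?_
  intro x hx y hy hxy
  simp only [← zpow_natCast, inv_zpow'] at hxy
  have h1 : (T ^ ((rhoMinusPt T u v y : ℤ) - rhoMinusPt T u v x)) x = y := by
    rw [sub_eq_add_neg, zpow_add, Equiv.Perm.mul_apply, hxy, ← Equiv.Perm.mul_apply, ← zpow_add]
    simp
  have h2 := h.reg x hx y hy _ h1
  rw [h2] at h1
  simpa using h1

theorem inv_pow_rhoMinusPt_mem_entryPoints (h : RegularTranslation T l r D) (hu : l ≤ u) {z : ℝ}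
    (hz : z ∈ insert l D) (hhit : ∀ z ∈ Ico l r, ∃ k : ℕ, (T⁻¹ ^ k) z ∈ Ioo u v) :
    (T⁻¹ ^ rhoMinusPt T u v z) z ∈ entryPoints T D u v := by
  rcases Finset.mem_insert.1 hz with rfl | hz
  · obtain ⟨y, hy, hyz⟩ := h.start
    set m := rhoMinusPt T u v y with hm
    have hyw : ∀ i ≤ m, (T ^ i) ((T⁻¹ ^ m) y) = (T⁻¹ ^ (m - i)) y := by
      intro i hi
      conv_lhs => rw [← Nat.add_sub_cancel' hi, pow_add, Equiv.Perm.mul_apply, inv_pow,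
        perm_apply_inv_apply]
    rw [(rhoMinusPt_eq_of_first (j := m + 1) (y := z)
      (rhoMinusPt_spec (hhit y (Ioo_subset_Ico_self (h.sub y hy)))) ?_ ?_).2]
    · exact Finset.mem_image_of_mem _ hy
    · rw [pow_succ', Equiv.Perm.mul_apply, hyw m le_rfl]
      simpa using hyz
    · intro i hi0 hi hmem
      rcases Nat.lt_or_ge m i with him | him
      · rw [show i = m + 1 by omega, pow_succ', Equiv.Perm.mul_apply, hyw m le_rfl] at hmem
        simp only [Nat.sub_self, pow_zero, Equiv.Perm.one_apply, hyz] at hmem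
        exact absurd hmem.1 (not_lt.2 hu)
      · rw [hyw i him] at hmem
        have := Nat.sInf_le (s := {n : ℕ | (T⁻¹ ^ n) y ∈ Ioo u v}) hmem
        rw [rhoMinusPt] at hm
        omega
  · exact Finset.mem_image_of_mem _ hz

/-- On an admissible semi-interval, the cut points are the first backward entries of the
separation points. -/
theorem allCuts_subset_entryPoints (h : RegularTranslation T l r D) (hu : l ≤ u) (hv : v ≤ r)
    (hhit : ∀ z ∈ Ico l r, ∃ k : ℕ, (T⁻¹ ^ k) z ∈ Ioo u v)
    (hadm : ∀ e ∈ ({u, v} : Set ℝ), (∃ z ∈ insert l D, e ∈ neighbours T u v z) ∨ e = r) :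
    allCuts T D u v ⊆ entryPoints T D u v := by
  have hlD : ∀ z ∈ insert l D, z ∈ Ico l r := by
    intro z hz
    rcases Finset.mem_insert.1 hz with rfl | hz
    · exact ⟨le_rfl, h.lt⟩
    · exact Ioo_subset_Ico_self (h.sub z hz)
  refine iUnion_subset fun k => ?_
  rintro x ⟨hx, ⟨j, -, hfirst, hD⟩ | ⟨j, hj0, -, hfirst, he⟩⟩
  · rw [← (rhoMinusPt_eq_of_first hx rfl fun i h1 h2 hi =>
      hfirst i h1 h2 (Ioo_subset_Ico_self hi)).2]
    exact Finset.mem_image_of_mem (fun x => (T⁻¹ ^ rhoMinusPt T u v x) x) hD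
  · have hxr : (T ^ j) x ∈ Ico l r := (h.pow_mem_iff j x).2 ⟨hu.trans hx.1.le, hx.2.trans_le hv⟩
    rcases hadm _ he with ⟨z, hz, hn⟩ | hr
    · have hin : (T ^ j) x ∉ Ioo u v := by
        rcases he with he | he <;> rw [he] <;> simp
      rw [← (rhoMinusPt_eq_of_first hx rfl fun i h1 h2 hi => by
        rcases h2.lt_or_eq with h2 | rfl
        · exact hfirst i h1 h2 (Ioo_subset_Ico_self hi)
        · exact hin hi).2, inv_pow_rhoMinusPt_eq_of_mem_neighbours (hhit z (hlD z hz)) hn]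
      exact h.inv_pow_rhoMinusPt_mem_entryPoints hu hz hhit
    · exact absurd hxr.2 (not_lt.2 hr.ge)

theorem exists_nearOrbit_of_mem_neighbours (h : RegularTranslation T l r D) (huv : u < v)
    (huv' : v - u ≤ r - l)
    (hhit : ∀ z ∈ Ico l r, (∃ k : ℕ, k * (v - u) ≤ C ∧ (T⁻¹ ^ k) z ∈ Ioo u v) ∧
      ∃ k : ℕ, 0 < k ∧ k * (v - u) ≤ C ∧ (T ^ k) z ∈ Ioo u v)
    {z e : ℝ} (hz : z ∈ insert l D) (he : e ∈ neighbours T u v z) :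
    ∃ n : ℕ, n * (v - u) ≤ C + (r - l) ∧ NearOrbit T D n e := by
  have huv0 := sub_pos.2 huv
  have hD : NearOrbit T D 1 z := by
    rcases Finset.mem_insert.1 hz with rfl | hz
    · obtain ⟨y, hy, hyz⟩ := h.start
      exact ⟨y, hy, 1, by simp, by simpa using hyz.symm⟩
    · exact (nearOrbit_zero hz).mono zero_le_one
  have hzI := h.nearOrbit_mem_Ico hD
  obtain ⟨⟨a, ha, ha'⟩, b, hb0, hb, hb'⟩ := hhit z hzI
  obtain ⟨k, hk1, hk2, rfl⟩ := he
  have hka : -(a : ℤ) ≤ k := by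
    have : rhoMinusPt T u v z ≤ a := Nat.sInf_le ha'
    omega
  have hkb : k < b := by
    have : rhoPlusPt T u v z ≤ b := Nat.sInf_le ⟨hb0, hb'⟩
    omega
  refine ⟨1 + k.natAbs, ?_, hD.zpow (Int.abs_eq_natAbs k).le⟩
  have hk : (k.natAbs : ℝ) * (v - u) ≤ C := by
    rcases le_total 0 k with h0 | h0
    · exact (mul_le_mul_of_nonneg_right (by exact_mod_cast (by omega : k.natAbs ≤ b))
        huv0.le).trans hb
    · exact (mul_le_mul_of_nonneg_right (by exact_mod_cast (by omega : k.natAbs ≤ a))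
        huv0.le).trans ha
  push_cast at hk ⊢
  linarith

theorem exists_nearOrbit_of_mem_entryPoints (h : RegularTranslation T l r D) (huv : u < v)
    (hhit : ∀ z ∈ Ico l r, ∃ k : ℕ, k * (v - u) ≤ C ∧ (T⁻¹ ^ k) z ∈ Ioo u v)
    {e : ℝ} (he : e ∈ entryPoints T D u v) :
    ∃ n : ℕ, n * (v - u) ≤ C ∧ NearOrbit T D n e := by
  obtain ⟨x, hx, rfl⟩ := Finset.mem_image.1 he
  obtain ⟨k, hk, hk'⟩ := hhit x (Ioo_subset_Ico_self (h.sub x hx))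
  have hle : rhoMinusPt T u v x ≤ k := Nat.sInf_le hk'
  refine ⟨rhoMinusPt T u v x, (mul_le_mul_of_nonneg_right (by exact_mod_cast hle)
    (sub_pos.2 huv).le).trans hk, x, hx, -(rhoMinusPt T u v x : ℤ), by simp, ?_⟩
  rw [zpow_neg, zpow_natCast, inv_pow]

end RegularTranslation

theorem exists_finset_representatives {α β : Type*} (R : α → β → Prop) {G : Set β}
    (hG : G.Finite) : ∃ F : Finset α, ∀ a, ∀ g ∈ G, R a g → ∃ w ∈ F, R w g := by
  classical
  induction G, hG using Set.Finite.induction_on with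
  | empty => exact ⟨∅, by simp⟩
  | @insert g G _ _ ih =>
    obtain ⟨F, hF⟩ := ih
    by_cases hg : ∃ w, R w g
    · obtain ⟨w, hw⟩ := hg
      refine ⟨insert w F, fun a g' hg' ha => ?_⟩
      rcases hg' with rfl | hg'
      · exact ⟨w, Finset.mem_insert_self _ _, hw⟩
      · obtain ⟨w', hw', h'⟩ := hF a g' hg' ha
        exact ⟨w', Finset.mem_insert_of_mem hw', h'⟩
    · refine ⟨F, fun a g' hg' ha => ?_⟩
      rcases hg' with rfl | hg'
      · exact absurd ⟨a, ha⟩ hg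
      · exact hF a g' hg' ha

theorem Admissible.exists_inducedData {d : ℤ} {s N : ℕ} {l r A C u v : ℝ} {len : Fin s → ℝ}
    {T : Equiv.Perm ℝ} (hadm : Admissible s l r len T u v) (hs : 0 < s)
    (hpos : ∀ i, 0 < len i) (h : RegularTranslation T l r (sepFinset l len)) (hA : 0 < A)
    (hC : 0 < C) (hr : ConjBound d N A (r - l))
    (hconj : ∀ n p, NearOrbit T (sepFinset l len) n p → ConjBound d N (A * (n + 1)) (p - l))
    (hhit : ∀ z ∈ Ico l r, (∃ k : ℕ, k * (v - u) ≤ C ∧ (T⁻¹ ^ k) z ∈ Ioo u v) ∧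
      ∃ k : ℕ, 0 < k ∧ k * (v - u) ≤ C ∧ (T ^ k) z ∈ Ioo u v) :
    ∃ (lam : Fin s → ℝ) (σ : Equiv.Perm (Fin s)), InducedData T u v s lam σ ∧
      ∀ i, 0 < lam i ∧ lam i ≤ v - u ∧
        ConjBound d N (2 * A * (C + 2 * (r - l)) / (v - u)) (lam i) := by
  obtain ⟨hu, huv, hv, hdu, hdv⟩ := hadm
  have huv0 := sub_pos.2 huv
  have hdiv : ∀ e ∈ divPoints s l len T u v ∪ {r},
      (∃ z ∈ insert l (sepFinset l len), e ∈ neighbours T u v z) ∨ e = r := by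
    rintro e (he | he)
    · obtain ⟨i, hi⟩ := mem_iUnion.1 he
      refine Or.inl ⟨_, ?_, hi⟩
      by_cases h0 : (i : ℕ) = 0
      · rw [sepPt_of_val_eq_zero h0]
        exact Finset.mem_insert_self _ _
      · exact Finset.mem_insert_of_mem (mem_sepFinset.2 ⟨i, h0, rfl⟩)
    · exact Or.inr he
  have hhit' : ∀ z ∈ Ico l r, ∃ k : ℕ, (T⁻¹ ^ k) z ∈ Ioo u v := fun z hz =>
    (hhit z hz).1.imp fun _ hk => hk.2
  have hsmall : ∀ e, (∃ n : ℕ, n * (v - u) ≤ C + (r - l) ∧ NearOrbit T (sepFinset l len) n e) ∨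
      e = r → ConjBound d N (A * (C + 2 * (r - l)) / (v - u)) (e - l) := by
    rintro e (⟨n, hn, he⟩ | rfl)
    · refine (hconj n e he).mono ?_
      rw [mul_div_assoc]
      refine mul_le_mul_of_nonneg_left ?_ hA.le
      rw [le_div_iff₀ huv0]
      linarith
    · refine hr.mono ?_
      rw [mul_div_assoc]
      refine le_mul_of_one_le_right hA.le ?_
      rw [le_div_iff₀ huv0]
      linarith
  have hends : ∀ e ∈ divPoints s l len T u v ∪ {r},
      ConjBound d N (A * (C + 2 * (r - l)) / (v - u)) (e - l) := by
    intro e he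
    refine hsmall e ((hdiv e he).imp_left ?_)
    rintro ⟨z, hz, hze⟩
    exact h.exists_nearOrbit_of_mem_neighbours huv (by linarith) hhit hz hze
  have hentry : ∀ e ∈ entryPoints T (sepFinset l len) u v,
      ConjBound d N (A * (C + 2 * (r - l)) / (v - u)) (e - l) := by
    intro e he
    obtain ⟨n, hn, hne⟩ := h.exists_nearOrbit_of_mem_entryPoints huv (fun z hz => (hhit z hz).1) he
    exact hsmall e (Or.inl ⟨n, by linarith [h.lt], hne⟩)
  have hP : ∀ x ∈ entryPoints T (sepFinset l len) u v, x ∈ Ioo u v := by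
    intro x hx
    obtain ⟨y, hy, rfl⟩ := Finset.mem_image.1 hx
    exact rhoMinusPt_spec (hhit' y (Ioo_subset_Ico_self (h.sub y hy)))
  obtain ⟨lam, σ, hdata, hlam⟩ := h.toPiecewiseTranslation.exists_inducedData hu huv hv hP
    (h.allCuts_subset_entryPoints hu hv hhit' (by
      rintro e (rfl | rfl)
      · exact hdiv _ hdu
      · exact hdiv _ hdv))
    (s := s) (by rw [h.card_entryPoints, card_sepFinset hs hpos])
  refine ⟨lam, σ, hdata, fun i => ?_⟩
  obtain ⟨hl0, hl1, p, hp, q, hq, hpq⟩ := hlam i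
  refine ⟨hl0, hl1, ?_⟩
  have hp' : ConjBound d N (A * (C + 2 * (r - l)) / (v - u)) (p - l) := by
    rcases Finset.mem_insert.1 hp with rfl | hp
    · exact hends _ hdu
    · exact hentry _ hp
  have hq' : ConjBound d N (A * (C + 2 * (r - l)) / (v - u)) (q - l) := by
    rcases Finset.mem_insert.1 hq with rfl | hq
    · exact hends _ hdv
    · exact hentry _ hq
  have := hq'.sub hp'
  rw [sub_sub_sub_cancel_right, ← hpq] at this
  refine this.mono (le_of_eq ?_)
  ring

/-- main theorem. Let `T` be a regular interval exchange
transformation whose lengths all belong to the quadratic field `ℚ(√d)`. Then the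
transformations induced by `T` on admissible semi-intervals fall into finitely
many equivalence classes. -/
theorem finitely_many_induced_classes_on_admissibles (d : ℤ) (hd : 2 ≤ d)
    (hsf : Squarefree d) (s : ℕ) (hs : 2 ≤ s) (l r : ℝ) (len : Fin s → ℝ)
    (π : Equiv.Perm (Fin s)) (T : Equiv.Perm ℝ)
    (hIET : IsIET s l r len π T) (hreg : IsRegularIET s l len T)
    (hQ : ∀ i : Fin s, ∃ p q : ℚ, len i = (p : ℝ) + (q : ℝ) * Real.sqrt d) :
    ∃ F : Finset (ℝ × ℝ), ∀ u v : ℝ, Admissible s l r len T u v →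
      ∃ w ∈ F, Admissible s l r len T w.1 w.2 ∧
        ∃ (lam mu : Fin s → ℝ) (σ₁ σ₂ : Equiv.Perm (Fin s)),
          InducedData T u v s lam σ₁ ∧
          InducedData T w.1 w.2 s mu σ₂ ∧
          IETEquiv s σ₁ σ₂ lam mu := by
  have hnsq : ∀ k : ℤ, d ≠ k * k := by
    rintro k rfl
    have := Int.isUnit_iff_abs_eq.1 (hsf k dvd_rfl)
    have h1 : k * k = |k| * |k| := (abs_mul_abs_self k).symm
    rw [h1, this] at hd
    omega
  have hT := hIET.regularTranslation hs hreg
  obtain ⟨N, hN, A, hA, hr, hconj⟩ := hIET.exists_conjBound hQ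
  obtain ⟨C, hC, hhit⟩ := hT.exists_hitting_le (c := 1 / (4 * A * N)) (by positivity)
    (orbitGap_of_conjBound (by omega) hnsq hN hA hconj)
  obtain ⟨η, hη, hunit⟩ := exists_unit_conjBound (by omega : 1 ≤ d) hnsq
  have hη0 : 0 < η := by linarith
  have hlr : 0 < r - l := sub_pos.2 hIET.1
  set K := 2 * A * (C + 2 * (r - l)) with hK
  have hK0 : 0 < K := by positivity
  have hfin := ConjBound.finite_setOf_abs_le (d := d) (N := N) (by omega) hN 1 (η * K)
  obtain ⟨F, hF⟩ := exists_finset_representatives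
    (fun (w : ℝ × ℝ) (g : Equiv.Perm (Fin s) × (Fin s → ℝ)) => Admissible s l r len T w.1 w.2 ∧
      ∃ (lam : Fin s → ℝ) (c : ℝ), 0 < c ∧ InducedData T w.1 w.2 s lam g.1 ∧
        ∀ i, g.2 i = c * lam i)
    (Set.finite_univ.prod (Set.Finite.pi' fun _ => hfin))
  refine ⟨F, fun u v hadm => ?_⟩
  have huv0 : 0 < v - u := sub_pos.2 hadm.2.1
  obtain ⟨lam, σ, hdata, hlam⟩ := hadm.exists_inducedData (by omega) hIET.2.1 hT hA hC hr hconj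
    (hhit u v hadm.1 hadm.2.1 hadm.2.2.1)
  obtain ⟨k, hk1, hk2⟩ := exists_mem_Ico_zpow (inv_pos.2 huv0) hη
  have hηk : 0 < η ^ k := zpow_pos hη0 k
  have hle1 : η ^ k * (v - u) ≤ 1 := by
    rwa [← one_div, le_div_iff₀ huv0] at hk1
  have hle2 : (η ^ k)⁻¹ * (K / (v - u)) ≤ η * K := by
    rw [zpow_add_one₀ hη0.ne'] at hk2
    have h1 : (η ^ k)⁻¹ * (v - u)⁻¹ ≤ η := by
      rw [inv_mul_le_iff₀ hηk]
      exact hk2.le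
    calc (η ^ k)⁻¹ * (K / (v - u)) = (η ^ k)⁻¹ * (v - u)⁻¹ * K := by ring
      _ ≤ η * K := mul_le_mul_of_nonneg_right h1 hK0.le
  have hle3 : ∀ i, |η ^ k * lam i| ≤ 1 := fun i => by
    rw [abs_of_pos (mul_pos hηk (hlam i).1)]
    exact (mul_le_mul_of_nonneg_left (hlam i).2.1 hηk.le).trans hle1
  obtain ⟨w, hwF, hw, mu, c, hc, hmu, hcmu⟩ := hF (u, v) (σ, fun i => η ^ k * lam i)
    ⟨mem_univ _, fun i => ⟨hle3 i, (hunit N _ _ k (hlam i).2.2).mono hle2⟩⟩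
    ⟨hadm, lam, η ^ k, hηk, hdata, fun _ => rfl⟩
  refine ⟨w, hwF, hw, lam, mu, σ, σ, hdata, hmu, Or.inl ⟨c⁻¹ * η ^ k, by positivity, rfl,
    fun i => ?_⟩⟩
  have := hcmu i
  simp only at this
  rw [mul_assoc, this, inv_mul_cancel_left₀ hc.ne']

end
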